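/- Let d : ℕ with d ≥ 2, and assume ringKrullDim R = d, 𝔞 ≠ R, and 𝔞 has positive height. Then there is a surjective R-linear map from ⊕_{i ∈ ℕ} H^d_𝔪(R) onto H^{d+1}_{𝔪_S}(S), the (d+1)-st local cohomology of the Rees algebra S (as a module over itself) at its maximal homogeneous ideal 𝔪_S, viewed as an R-module by restriction of scalars. -/

import Mathlib

set_option synthInstance.maxHeartbeats 1000000
set_option maxHeartbeats 1000000

open LaurentPolynomial IsLocalRing

section

universe u

section LocalCohomology

open CategoryTheory Limits

lemma Iso.inv_comp_of_comp_hom {C : Type*} [Category* C] {X X' Y Y' : C} (a : X ≅ X')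
    (b : Y ≅ Y') {f : X ⟶ Y} {g : X' ⟶ Y'}
    (h : f ≫ b.hom = a.hom ≫ g) : a.inv ≫ f = g ≫ b.inv := by
  rw [Iso.inv_comp_eq, ← Category.assoc, ← h, Category.assoc, Iso.hom_inv_id, Category.comp_id]

section
variable {A : Type u} [CommRing A] {C : Type*} [Category.{u} C] [Abelian C] [Linear A C]

noncomputable def linearYonedaObjMap {P Q : ChainComplex C ℕ} (φ : P ⟶ Q) (Y : C) :
    Q.linearYonedaObj A Y ⟶ P.linearYonedaObj A Y :=
  (HomologicalComplex.unopFunctor _ _).map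
    ((((linearYoneda A C).obj Y).rightOp.mapHomologicalComplex _).map φ).op

lemma isoExt_naturality [EnoughProjectives C] {X X' : C} (P : ProjectiveResolution X)
    (P' : ProjectiveResolution X') (f : X' ⟶ X) (φ : ProjectiveResolution.Hom P' P f) (n : ℕ) (Y : C) :
    ((Ext A C n).map f.op).app Y ≫ (P'.isoExt n Y).hom =
      (P.isoExt n Y).hom ≫ HomologicalComplex.homologyMap (linearYonedaObjMap φ.hom Y) n := by
  have hφ : φ.hom.f 0 ≫ P.π.f 0 = P'.π.f 0 ≫ f :=
    φ.hom_f_zero_comp_π_f_zero.trans (by simp)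
  let G := ((linearYoneda A C).obj Y).rightOp
  let mφ := (G.mapHomologicalComplex (ComplexShape.down ℕ)).map φ.hom
  have h1 : (G.leftDerived n).map f ≫ (P.isoLeftDerivedObj G n).hom =
      (P'.isoLeftDerivedObj G n).hom ≫ HomologicalComplex.homologyMap mφ n :=
    ProjectiveResolution.isoLeftDerivedObj_hom_naturality f P' P φ.hom hφ G n
  have h2 : HomologicalComplex.homologyMap mφ n ≫
      (((G.mapHomologicalComplex (ComplexShape.down ℕ)).obj P.complex).unop.homologyOp n).hom =
      (((G.mapHomologicalComplex (ComplexShape.down ℕ)).obj P'.complex).unop.homologyOp n).hom ≫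
        (HomologicalComplex.homologyMap (linearYonedaObjMap (A := A) φ.hom Y) n).op :=
    HomologicalComplex.homologyOp_hom_naturality (linearYonedaObjMap (A := A) φ.hom Y) n
  apply Quiver.Hom.op_inj
  have h3 : ∀ {X : C} (P : ProjectiveResolution X), (P.isoExt (R := A) n Y).hom.op =
      (((G.mapHomologicalComplex (ComplexShape.down ℕ)).obj P.complex).unop.homologyOp n).inv ≫
        (P.isoLeftDerivedObj G n).inv := fun P => rfl
  have h4 := Iso.inv_comp_of_comp_hom _ _ h1
  have h5 := Iso.inv_comp_of_comp_hom _ _ h2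
  have h6 := congrArg (fun z =>
    (((G.mapHomologicalComplex (ComplexShape.down ℕ)).obj P'.complex).unop.homologyOp n).inv ≫ z) h4
  have h7 := congrArg (fun z => z ≫ (P.isoLeftDerivedObj G n).inv) h5
  exact (Category.assoc _ _ _).trans (h6.trans ((Category.assoc _ _ _).symm.trans
    (h7.trans (Category.assoc _ _ _))))

noncomputable def cycleHom {X : C} (P : ProjectiveResolution X) (n : ℕ) (Y : C)
    (z : (P.complex.linearYonedaObj A Y).cycles n) : P.complex.X n ⟶ Y :=
  ((P.complex.linearYonedaObj A Y).iCycles n).hom z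

lemma cycleHom_add {X : C} (P : ProjectiveResolution X) (n : ℕ) (Y : C)
    (z w : (P.complex.linearYonedaObj A Y).cycles n) :
    cycleHom P n Y (z + w) = cycleHom P n Y z + cycleHom P n Y w :=
  map_add ((P.complex.linearYonedaObj A Y).iCycles n).hom z w

lemma cycleHom_smul {X : C} (P : ProjectiveResolution X) (n : ℕ) (Y : C)
    (r : A) (z : (P.complex.linearYonedaObj A Y).cycles n) :
    cycleHom P n Y (r • z) = r • cycleHom P n Y z :=
  map_smul ((P.complex.linearYonedaObj A Y).iCycles n).hom r z

lemma cycleHom_zero {X : C} (P : ProjectiveResolution X) (n : ℕ) (Y : C) :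
    cycleHom (A := A) P n Y 0 = 0 :=
  map_zero ((P.complex.linearYonedaObj A Y).iCycles n).hom

lemma d_comp_cycleHom {X : C} (P : ProjectiveResolution X) (n : ℕ) (Y : C)
    (z : (P.complex.linearYonedaObj A Y).cycles n) :
    P.complex.d (n + 1) n ≫ cycleHom P n Y z = 0 :=
  ConcreteCategory.congr_hom ((P.complex.linearYonedaObj A Y).iCycles_d n (n + 1)) z

lemma exists_cycleHom_eq {X : C} (P : ProjectiveResolution X) (n : ℕ) (Y : C)
    (f : P.complex.X n ⟶ Y) (hf : P.complex.d (n + 1) n ≫ f = 0) :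
    ∃ z, cycleHom (A := A) P n Y z = f := by
  let K := P.complex.linearYonedaObj A Y
  let k : ModuleCat.of A A ⟶ K.X n :=
    ModuleCat.ofHom (LinearMap.toSpanSingleton A (P.complex.X n ⟶ Y) f)
  have hk : k ≫ K.d n (n + 1) = 0 := by
    ext
    change (K.d n (n+1)).hom ((1 : A) • f) = 0
    rw [one_smul]
    exact hf
  refine ⟨(K.liftCycles k (n + 1) (by simp) hk).hom (1 : A), ?_⟩
  exact (ConcreteCategory.congr_hom (K.liftCycles_i k (n + 1) (by simp) hk) (1 : A)).trans
    (one_smul A f)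

lemma cycleHom_injective {X : C} (P : ProjectiveResolution X) (n : ℕ) (Y : C) :
    Function.Injective (cycleHom (A := A) P n Y) :=
  (ModuleCat.mono_iff_injective ((P.complex.linearYonedaObj A Y).iCycles n)).1 inferInstance

lemma cycleHom_cyclesMap {X X' : C} (P : ProjectiveResolution X) (P' : ProjectiveResolution X')
    (φ : P'.complex ⟶ P.complex) (n : ℕ) (Y : C)
    (z : (P.complex.linearYonedaObj A Y).cycles n) :
    cycleHom P' n Y ((HomologicalComplex.cyclesMap (linearYonedaObjMap φ Y) n).hom z) =
      φ.f n ≫ cycleHom P n Y z :=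
  ConcreteCategory.congr_hom (HomologicalComplex.cyclesMap_i (linearYonedaObjMap φ Y) n) z

lemma homologyπ_eq_zero_iff (K : CochainComplex (ModuleCat A) ℕ) (n : ℕ) (z : K.cycles n) :
    (K.homologyπ n).hom z = 0 ↔
      ∃ y : K.X ((ComplexShape.up ℕ).prev n), (K.toCycles _ n).hom y = z := by
  have h := (ShortComplex.exact_of_g_is_cokernel
    (ShortComplex.mk _ _ (K.toCycles_comp_homologyπ _ n)) (K.homologyIsCokernel _ n rfl))
  rw [ShortComplex.moduleCat_exact_iff] at h
  refine ⟨fun hz => h z hz, ?_⟩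
  rintro ⟨y, rfl⟩
  exact ConcreteCategory.congr_hom (K.toCycles_comp_homologyπ _ n) y

variable [HasExt.{u} C]

open CochainComplex.HomComplex in
lemma extMk_zero_eq_zero_iff {X Y : C} (P : ProjectiveResolution X) (f : P.complex.X 0 ⟶ Y)
    (hf : P.complex.d 1 0 ≫ f = 0) : P.extMk f 1 rfl hf = 0 ↔ f = 0 := by
  constructor
  · intro h
    rw [← P.extEquivCohomologyClass.apply_eq_iff_eq,
      ProjectiveResolution.extEquivCohomologyClass_extMk,
      ProjectiveResolution.extEquivCohomologyClass_zero, CohomologyClass.mk_eq_zero_iff,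
      Cocycle.toSingleMk_mem_coboundaries_iff _ _ _ _ _ 1 (by lia)] at h
    obtain ⟨g, hg⟩ := h
    have hg0 : P.cochainComplex.d (-((0 : ℕ) : ℤ)) 1 = 0 :=
      (P.cochainComplex.isZero_of_isStrictlyLE 0 1 (by lia)).eq_of_tgt _ _
    rw [hg0, zero_comp] at hg
    exact (cancel_epi (P.cochainComplexXIso (-((0 : ℕ) : ℤ)) 0 rfl).hom).1
      (hg.symm.trans comp_zero.symm)
  · rintro rfl
    simp

noncomputable def cyclesToExt {X : C} (P : ProjectiveResolution X) (n : ℕ) (Y : C) :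
    (P.complex.linearYonedaObj A Y).cycles n →ₗ[A] Abelian.Ext X Y n where
  toFun z := P.extMk (cycleHom P n Y z) (n + 1) rfl (d_comp_cycleHom P n Y z)
  map_add' a b := by
    rw [P.add_extMk]; congr 1; exact cycleHom_add ..
  map_smul' r a := by
    rw [RingHom.id_apply, Abelian.Ext.smul_eq_comp_mk₀, P.extMk_comp_mk₀]
    congr 1
    rw [cycleHom_smul, Linear.comp_smul, Category.comp_id]

lemma cyclesToExt_surjective {X : C} (P : ProjectiveResolution X) (n : ℕ) (Y : C) :
    Function.Surjective (cyclesToExt (A := A) P n Y) := by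
  intro α
  obtain ⟨f, hf, rfl⟩ := P.extMk_surjective α (n + 1) rfl
  obtain ⟨z, rfl⟩ := exists_cycleHom_eq (A := A) P n Y f hf
  exact ⟨z, rfl⟩

lemma cyclesToExt_eq_zero_iff {X : C} (P : ProjectiveResolution X) (n : ℕ) (Y : C)
    (z : (P.complex.linearYonedaObj A Y).cycles n) :
    cyclesToExt P n Y z = 0 ↔ ((P.complex.linearYonedaObj A Y).homologyπ n).hom z = 0 := by
  rw [homologyπ_eq_zero_iff]
  let K := P.complex.linearYonedaObj A Y
  have key : ∀ (p : ℕ) (y : K.X p),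
      cycleHom P n Y ((K.toCycles p n).hom y) = P.complex.d n p ≫ (show P.complex.X p ⟶ Y from y) :=
    fun p y => ConcreteCategory.congr_hom (K.toCycles_i p n) y
  cases n with
  | zero =>
    have hz : cyclesToExt P 0 Y z = 0 ↔ cycleHom P 0 Y z = 0 :=
      extMk_zero_eq_zero_iff P _ (d_comp_cycleHom P 0 Y z)
    rw [hz]
    have h0 (y) : ((P.complex.linearYonedaObj A Y).toCycles ((ComplexShape.up ℕ).prev 0) 0).hom y =
        0 := by
      rw [HomologicalComplex.toCycles_eq_zero _ (by simp)]; rfl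
    simp only [h0]
    constructor
    · intro h
      exact ⟨0, cycleHom_injective P _ Y ((cycleHom_zero P 0 Y).trans h.symm)⟩
    · rintro ⟨g, rfl⟩
      exact cycleHom_zero P 0 Y
  | succ p =>
    rw [CochainComplex.prev_nat_succ]
    refine (P.extMk_eq_zero_iff _ (p + 2) rfl (d_comp_cycleHom P (p + 1) Y z) p rfl).trans ?_
    constructor
    · rintro ⟨g, hg⟩
      exact ⟨g, cycleHom_injective P _ Y ((key p g).trans hg)⟩
    · rintro ⟨g, rfl⟩
      exact ⟨g, (key p g).symm⟩

lemma cyclesToExt_naturality {X X' : C} (P : ProjectiveResolution X)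
    (P' : ProjectiveResolution X') (f : X' ⟶ X) (φ : ProjectiveResolution.Hom P' P f) (n : ℕ) (Y : C)
    (z : (P.complex.linearYonedaObj A Y).cycles n) :
    cyclesToExt P' n Y ((HomologicalComplex.cyclesMap (linearYonedaObjMap φ.hom Y) n).hom z) =
      (Abelian.Ext.mk₀ f).comp (cyclesToExt P n Y z) (zero_add n) := by
  refine Eq.trans ?_ (ProjectiveResolution.mk₀_comp_extMk (cycleHom P n Y z) (n + 1) rfl
    (d_comp_cycleHom P n Y z) φ).symm
  simp only [cyclesToExt, LinearMap.coe_mk, AddHom.coe_mk]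
  congr 1
  exact cycleHom_cyclesMap P P' φ.hom n Y z

noncomputable def homologyToExt {X : C} (P : ProjectiveResolution X) (n : ℕ) (Y : C) :
    (P.complex.linearYonedaObj A Y).homology n ≃ₗ[A] Abelian.Ext X Y n :=
  (LinearMap.quotKerEquivOfSurjective ((P.complex.linearYonedaObj A Y).homologyπ n).hom
    ((ModuleCat.epi_iff_surjective _).1 inferInstance)).symm ≪≫ₗ
  Submodule.quotEquivOfEq _ _ (by
    ext z
    exact (cyclesToExt_eq_zero_iff P n Y z).symm) ≪≫ₗ
  LinearMap.quotKerEquivOfSurjective (cyclesToExt P n Y) (cyclesToExt_surjective P n Y)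

lemma homologyToExt_homologyπ {X : C} (P : ProjectiveResolution X) (n : ℕ) (Y : C)
    (z : (P.complex.linearYonedaObj A Y).cycles n) :
    homologyToExt P n Y (((P.complex.linearYonedaObj A Y).homologyπ n).hom z) =
      cyclesToExt P n Y z := by
  have h : (LinearMap.quotKerEquivOfSurjective ((P.complex.linearYonedaObj A Y).homologyπ n).hom
      ((ModuleCat.epi_iff_surjective _).1 inferInstance)).symm
        (((P.complex.linearYonedaObj A Y).homologyπ n).hom z) = Submodule.Quotient.mk z := by
    rw [LinearEquiv.symm_apply_eq]
    rfl
  simp only [homologyToExt, LinearEquiv.trans_apply]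
  rw [h]
  rfl

lemma homologyToExt_naturality {X X' : C} (P : ProjectiveResolution X)
    (P' : ProjectiveResolution X') (f : X' ⟶ X) (φ : ProjectiveResolution.Hom P' P f) (n : ℕ)
    (Y : C) (z : (P.complex.linearYonedaObj A Y).homology n) :
    homologyToExt P' n Y
        ((HomologicalComplex.homologyMap (linearYonedaObjMap φ.hom Y) n).hom z) =
      (Abelian.Ext.mk₀ f).comp (homologyToExt P n Y z) (zero_add n) := by
  obtain ⟨z, rfl⟩ := (ModuleCat.epi_iff_surjective
    ((P.complex.linearYonedaObj A Y).homologyπ n)).1 inferInstance z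
  have h := ConcreteCategory.congr_hom
    (HomologicalComplex.homologyπ_naturality (linearYonedaObjMap (A := A) φ.hom Y) n) z
  refine (congrArg (homologyToExt P' n Y) h).trans ?_
  rw [homologyToExt_homologyπ]
  refine (homologyToExt_homologyπ P' n Y _).trans ?_
  exact cyclesToExt_naturality P P' f φ n Y z

variable [EnoughProjectives C]

noncomputable def extLinearEquiv (X Y : C) (n : ℕ) :
    ((Ext A C n).obj (Opposite.op X)).obj Y ≃ₗ[A] Abelian.Ext X Y n :=
  ((projectiveResolution X).isoExt n Y).toLinearEquiv ≪≫ₗ homologyToExt _ n Y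

lemma extLinearEquiv_naturality {X X' : C} (f : X' ⟶ X) (Y : C) (n : ℕ)
    (z : ((Ext A C n).obj (Opposite.op X)).obj Y) :
    extLinearEquiv X' Y n ((((Ext A C n).map f.op).app Y).hom z) =
      (Abelian.Ext.mk₀ f).comp (extLinearEquiv X Y n z) (zero_add n) := by
  let P := projectiveResolution X
  let P' := projectiveResolution X'
  let φ : ProjectiveResolution.Hom P' P f :=
    ⟨ProjectiveResolution.lift f P' P, by
      exact congrArg (fun g => HomologicalComplex.Hom.f g 0)
        (ProjectiveResolution.lift_commutes f P' P)⟩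
  have h := ConcreteCategory.congr_hom (isoExt_naturality (A := A) P P' f φ n Y) z
  refine Eq.trans ?_ (homologyToExt_naturality P P' f φ n Y ((P.isoExt n Y).hom.hom z))
  exact congrArg (homologyToExt P' n Y) h

end

section
variable {A : Type u} [CommRing A]

noncomputable abbrev powFactor (I : Ideal A) {j k : ℕ} (h : j ≤ k) :
    ModuleCat.of A (A ⧸ I ^ k) ⟶ ModuleCat.of A (A ⧸ I ^ j) :=
  ModuleCat.ofHom (Submodule.mapQ _ _ LinearMap.id (Ideal.pow_le_pow_right h))

abbrev ExtPow (I : Ideal A) (i : ℕ) (M : ModuleCat.{u} A) (k : ℕ) : Type u :=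
  Abelian.Ext (ModuleCat.of A (A ⧸ I ^ k)) M i

noncomputable abbrev extPowMap (I : Ideal A) (i : ℕ) (M : ModuleCat.{u} A) (j k : ℕ) (h : j ≤ k) :
    ExtPow I i M j →ₗ[A] ExtPow I i M k :=
  (Abelian.Ext.mk₀ (powFactor I h)).precompOfLinear A M (zero_add i)

lemma powFactor_comp (I : Ideal A) {j k l : ℕ} (h : j ≤ k) (h' : k ≤ l) :
    powFactor I h' ≫ powFactor I h = powFactor I (h.trans h') := by
  ext
  rfl

lemma powFactor_self (I : Ideal A) (k : ℕ) : powFactor I (le_refl k) = 𝟙 _ := by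
  ext
  rfl

instance (I : Ideal A) (i : ℕ) (M : ModuleCat.{u} A) :
    DirectedSystem (ExtPow I i M) fun j k h => extPowMap I i M j k h where
  map_self k x := by
    change (Abelian.Ext.mk₀ (powFactor I (le_refl k))).comp x (zero_add i) = x
    rw [powFactor_self, Abelian.Ext.mk₀_id_comp]
  map_map j k l h h' x := by
    change (Abelian.Ext.mk₀ (powFactor I _)).comp
      ((Abelian.Ext.mk₀ (powFactor I _)).comp x (zero_add i)) (zero_add i) = 
      (Abelian.Ext.mk₀ (powFactor I _)).comp x (zero_add i)
    rw [Abelian.Ext.mk₀_comp_mk₀_assoc, powFactor_comp]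

/-- The direct limit of the modules `Ext^i(A/I^k, M)`. -/
abbrev ExtLimit (I : Ideal A) (i : ℕ) (M : ModuleCat.{u} A) : Type u :=
  Module.DirectLimit (ExtPow I i M) (extPowMap I i M)

theorem exists_localCohomology_linearEquiv_extLimit {A : Type} [CommRing A] (I : Ideal A)
    (i : ℕ) (M : ModuleCat.{0} A) :
    Nonempty ((localCohomology I i).obj M ≃ₗ[A] ExtLimit I i M) := by
  let D := localCohomology.diagram (localCohomology.idealPowersDiagram I) i
  let F := D ⋙ (evaluation _ _).obj M
  suffices h : Nonempty ((colimit F : ModuleCat A) ≃ₗ[A] ExtLimit I i M) by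
    obtain ⟨e⟩ := h
    exact ⟨(colimitObjIsoColimitCompEvaluation D M).toLinearEquiv ≪≫ₗ e⟩
  let e (k : ℕ) : F.obj (Opposite.op (Opposite.op k)) ≃ₗ[A] ExtPow I i M k :=
    extLinearEquiv (ModuleCat.of A (A ⧸ I ^ k)) M i
  have he {j k : ℕ} (h : j ≤ k) (x : F.obj (Opposite.op (Opposite.op j))) :
      e k ((F.map (homOfLE h).op.op).hom x) = extPowMap I i M j k h (e j x) :=
    extLinearEquiv_naturality (powFactor I h) M i x
  let c : Cocone F :=
    { pt := ModuleCat.of A (ExtLimit I i M)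
      ι :=
        { app := fun k => ModuleCat.ofHom
            (Module.DirectLimit.of A ℕ _ (extPowMap I i M) k.unop.unop ∘ₗ (e k.unop.unop).toLinearMap)
          naturality := by
            intro j k f
            ext x
            have := he f.unop.unop.le x
            change Module.DirectLimit.of A ℕ _ (extPowMap I i M) k.unop.unop 
              (e k.unop.unop ((F.map f).hom x)) = 
              Module.DirectLimit.of A ℕ _ (extPowMap I i M) j.unop.unop (e j.unop.unop x)
            refine (congrArg _ this).trans ?_
            exact Module.DirectLimit.of_f } }
  have hc (k : ℕ) (x : F.obj (Opposite.op (Opposite.op k))) :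
      (colimit.desc F c).hom ((colimit.ι F _).hom x) =
        Module.DirectLimit.of A ℕ _ (extPowMap I i M) k (e k x) :=
    ConcreteCategory.congr_hom (colimit.ι_desc c (Opposite.op (Opposite.op k))) x
  refine ⟨LinearEquiv.ofBijective (colimit.desc F c).hom ⟨?_, ?_⟩⟩
  · rw [injective_iff_map_eq_zero]
    intro z hz
    obtain ⟨k, x, rfl⟩ := Concrete.colimit_exists_rep F z
    have hz' := (hc k.unop.unop x).symm.trans hz
    obtain ⟨l, hl, h0⟩ := Module.DirectLimit.of.zero_exact hz'
    rw [← he hl, LinearEquiv.map_eq_zero_iff] at h0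
    have h1 := ConcreteCategory.congr_hom (colimit.w F (homOfLE hl).op.op) x
    refine h1.symm.trans ?_
    refine (congrArg (colimit.ι F _).hom h0).trans (map_zero (colimit.ι F _).hom)
  · intro y
    obtain ⟨k, x, rfl⟩ := Module.DirectLimit.exists_of y
    obtain ⟨x, rfl⟩ := (e k).surjective x
    exact ⟨_, hc k x⟩

end

namespace ExtLimit

variable {A : Type u} [CommRing A] (I : Ideal A)

noncomputable abbrev of (i : ℕ) (M : ModuleCat.{u} A) (k : ℕ) :
    ExtPow I i M k →ₗ[A] ExtLimit I i M :=
  Module.DirectLimit.of A ℕ _ (extPowMap I i M) k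

/-- Composition with a fixed extension class. -/
noncomputable def post {M N : ModuleCat.{u} A} {a b c : ℕ} (β : Abelian.Ext M N b)
    (h : a + b = c) : ExtLimit I a M →ₗ[A] ExtLimit I c N :=
  Module.DirectLimit.map (fun _ => β.postcompOfLinear A _ h) (by
    intro j k hjk
    ext x
    exact (Abelian.Ext.comp_assoc (Abelian.Ext.mk₀ (powFactor I hjk)) x β (zero_add a) h (by lia)))

variable {I}

lemma post_of {M N : ModuleCat.{u} A} {a b c : ℕ} (β : Abelian.Ext M N b)
    (h : a + b = c) (k : ℕ) (x : ExtPow I a M k) :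
    post I β h (of I a M k x) = of I c N k (x.comp β h) :=
  Module.DirectLimit.map_apply_of _ _ x

lemma post_post {M N L : ModuleCat.{u} A} {a b c b' c' b'' : ℕ} (β : Abelian.Ext M N b)
    (h : a + b = c) (γ : Abelian.Ext N L b') (h' : c + b' = c') (h'' : b + b' = b'')
    (z : ExtLimit I a M) :
    post I γ h' (post I β h z) = post I (β.comp γ h'') (show a + b'' = c' by lia) z := by
  obtain ⟨k, x, rfl⟩ := Module.DirectLimit.exists_of z
  rw [post_of, post_of, post_of, Abelian.Ext.comp_assoc x β γ h h'' (by lia)]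

lemma exists_comp_eq_zero {M N : ModuleCat.{u} A} {a b c : ℕ} (β : Abelian.Ext M N b)
    (h : a + b = c) (z : ExtLimit I a M) (hz : post I β h z = 0) :
    ∃ k x, of I a M k x = z ∧ x.comp β h = 0 := by
  obtain ⟨k, x, rfl⟩ := Module.DirectLimit.exists_of z
  rw [post_of] at hz
  obtain ⟨l, hl, h0⟩ := Module.DirectLimit.of.zero_exact hz
  refine ⟨l, extPowMap I a M k l hl x, Module.DirectLimit.of_f, ?_⟩
  refine Eq.trans ?_ h0
  exact Abelian.Ext.comp_assoc (Abelian.Ext.mk₀ (powFactor I hl)) x β (zero_add a) h (by lia)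

lemma post_zero {M N : ModuleCat.{u} A} {a b c : ℕ} (h : a + b = c) (z : ExtLimit I a M) :
    post I (0 : Abelian.Ext M N b) h z = 0 := by
  obtain ⟨k, x, rfl⟩ := Module.DirectLimit.exists_of z
  rw [post_of, Abelian.Ext.comp_zero, map_zero]

end ExtLimit

section

variable {A : Type u} [CommRing A] (I : Ideal A) (i : ℕ)
  (M : Type u) [AddCommGroup M] [Module A M]

/-- The direct limit of the modules `Ext^i(A/I^k, M)`, a model of local cohomology. -/
def LC : Type u := ExtLimit I i (ModuleCat.of A M)

noncomputable instance : AddCommGroup (LC I i M) :=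
  inferInstanceAs (AddCommGroup (ExtLimit I i (ModuleCat.of A M)))

noncomputable instance : Module A (LC I i M) :=
  inferInstanceAs (Module A (ExtLimit I i (ModuleCat.of A M)))

theorem exists_localCohomology_linearEquiv {A : Type} [CommRing A] (I : Ideal A) (i : ℕ)
    (M : Type) [AddCommGroup M] [Module A M] :
    Nonempty ((localCohomology I i).obj (ModuleCat.of A M) ≃ₗ[A] LC I i M) :=
  exists_localCohomology_linearEquiv_extLimit I i (ModuleCat.of A M)

end

namespace LC

variable {A : Type u} [CommRing A] (I : Ideal A) (i : ℕ)
  {M N L : Type u} [AddCommGroup M] [Module A M] [AddCommGroup N] [Module A N]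
  [AddCommGroup L] [Module A L]

noncomputable def map (f : M →ₗ[A] N) : LC I i M →ₗ[A] LC I i N :=
  ExtLimit.post I (Abelian.Ext.mk₀ (ModuleCat.ofHom f)) (add_zero i)

variable {I i}

lemma map_map (f : M →ₗ[A] N) (g : N →ₗ[A] L) (z : LC I i M) :
    map I i g (map I i f z) = map I i (g ∘ₗ f) z := by
  refine (ExtLimit.post_post _ _ _ _ (add_zero 0) z).trans ?_
  rw [Abelian.Ext.mk₀_comp_mk₀]
  rfl

lemma map_smul_id (a : A) (z : LC I i M) : map I i (a • LinearMap.id) z = a • z := by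
  obtain ⟨k, x, rfl⟩ := Module.DirectLimit.exists_of z
  refine (ExtLimit.post_of _ _ k x).trans ?_
  refine Eq.trans ?_ (LinearMap.map_smul (ExtLimit.of I i (ModuleCat.of A M) k) a x)
  rw [Abelian.Ext.smul_eq_comp_mk₀]
  rfl

lemma map_id (z : LC I i M) : map I i LinearMap.id z = z := by
  simpa using map_smul_id (1 : A) z

lemma map_zero_apply (z : LC I i M) : map I i (0 : M →ₗ[A] N) z = 0 := by
  have : Abelian.Ext.mk₀ (ModuleCat.ofHom (0 : M →ₗ[A] N)) = 0 := Abelian.Ext.mk₀_zero _ _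
  unfold map
  rw [this]
  exact ExtLimit.post_zero _ z

lemma exists_pow_smul_eq_zero (z : LC I i M) : ∃ k, ∀ a ∈ I ^ k, a • z = 0 := by
  obtain ⟨k, x, rfl⟩ := Module.DirectLimit.exists_of z
  refine ⟨k, fun a ha => ?_⟩
  refine (LinearMap.map_smul (ExtLimit.of I i (ModuleCat.of A M) k) a x).symm.trans ?_
  have h0 : a • 𝟙 (ModuleCat.of A (A ⧸ I ^ k)) = 0 := by
    ext
    change a • (Submodule.Quotient.mk (1 : A) : A ⧸ I ^ k) = 0
    rw [← Submodule.Quotient.mk_smul, smul_eq_mul, mul_one]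
    exact (Submodule.Quotient.mk_eq_zero _).2 ha
  have : a • x = 0 := by
    conv_lhs => rw [← Abelian.Ext.mk₀_id_comp x]
    rw [← Abelian.Ext.smul_comp, ← Abelian.Ext.mk₀_smul, h0, Abelian.Ext.mk₀_zero,
      Abelian.Ext.zero_comp]
  rw [this, map_zero]
  rfl

lemma eq_zero_of_injective [Module.Injective A M] (z : LC I (i + 1) M) : z = 0 := by
  obtain ⟨k, x, rfl⟩ := Module.DirectLimit.exists_of z
  have := Module.injective_object_of_injective_module A M
  rw [Abelian.Ext.eq_zero_of_injective x, map_zero]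
  rfl

section Connecting

variable {f : M →ₗ[A] N} {g : N →ₗ[A] L}

lemma shortExact (hf : Function.Injective f) (hfg : Function.Exact f g)
    (hg : Function.Surjective g) :
    (ShortComplex.mk (ModuleCat.ofHom f) (ModuleCat.ofHom g)
      (by ext x; exact hfg.apply_apply_eq_zero x)).ShortExact :=
  ModuleCat.shortComplex_shortExact _ hfg hf hg

variable (I i) in
/-- The connecting homomorphism. -/
noncomputable def δ (hf : Function.Injective f) (hfg : Function.Exact f g)
    (hg : Function.Surjective g) : LC I i L →ₗ[A] LC I (i + 1) M :=
  ExtLimit.post I (shortExact hf hfg hg).extClass rfl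

lemma exact_map_map (hf : Function.Injective f) (hfg : Function.Exact f g)
    (hg : Function.Surjective g) : Function.Exact (map I i f) (map I i g) := by
  intro z
  constructor
  · intro hz
    obtain ⟨k, x, rfl, hx⟩ := ExtLimit.exists_comp_eq_zero _ _ z hz
    obtain ⟨y, rfl⟩ := Abelian.Ext.covariant_sequence_exact₂ _ (shortExact hf hfg hg) x hx
    exact ⟨ExtLimit.of I i _ k y, ExtLimit.post_of _ _ k y⟩
  · rintro ⟨y, rfl⟩
    rw [map_map, hfg.linearMap_comp_eq_zero]
    exact map_zero_apply y

lemma exact_map_δ (hf : Function.Injective f) (hfg : Function.Exact f g)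
    (hg : Function.Surjective g) : Function.Exact (map I i g) (δ I i hf hfg hg) := by
  intro z
  constructor
  · intro hz
    obtain ⟨k, x, rfl, hx⟩ := ExtLimit.exists_comp_eq_zero _ _ z hz
    obtain ⟨y, rfl⟩ := Abelian.Ext.covariant_sequence_exact₃ _ (shortExact hf hfg hg) x rfl hx
    exact ⟨ExtLimit.of I i _ k y, ExtLimit.post_of _ _ k y⟩
  · rintro ⟨y, rfl⟩
    refine (ExtLimit.post_post _ _ _ _ (zero_add 1) y).trans ?_
    rw [(shortExact hf hfg hg).comp_extClass]
    exact ExtLimit.post_zero _ y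

lemma exact_δ_map (hf : Function.Injective f) (hfg : Function.Exact f g)
    (hg : Function.Surjective g) : Function.Exact (δ I i hf hfg hg) (map I (i + 1) f) := by
  intro z
  constructor
  · intro hz
    obtain ⟨k, x, rfl, hx⟩ := ExtLimit.exists_comp_eq_zero _ _ z hz
    obtain ⟨y, rfl⟩ := Abelian.Ext.covariant_sequence_exact₁ _ (shortExact hf hfg hg) x hx rfl
    exact ⟨ExtLimit.of I i _ k y, ExtLimit.post_of _ _ k y⟩
  · rintro ⟨y, rfl⟩
    refine (ExtLimit.post_post _ _ _ _ (add_zero 1) y).trans ?_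
    rw [(shortExact hf hfg hg).extClass_comp]
    exact ExtLimit.post_zero _ y

lemma map_δ {M' N' L' : Type u} [AddCommGroup M'] [Module A M'] [AddCommGroup N'] [Module A N']
    [AddCommGroup L'] [Module A L'] {f' : M' →ₗ[A] N'} {g' : N' →ₗ[A] L'}
    (hf : Function.Injective f) (hfg : Function.Exact f g)
    (hg : Function.Surjective g) (hf' : Function.Injective f') (hfg' : Function.Exact f' g')
    (hg' : Function.Surjective g') (a : M →ₗ[A] M') (b : N →ₗ[A] N') (c : L →ₗ[A] L')
    (hab : b ∘ₗ f = f' ∘ₗ a) (hbc : c ∘ₗ g = g' ∘ₗ b) (z : LC I i L) :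
    map I (i + 1) a (δ I i hf hfg hg z) = δ I i hf' hfg' hg' (map I i c z) := by
  refine (ExtLimit.post_post _ _ _ _ (add_zero 1) z).trans ?_
  refine Eq.trans ?_ (ExtLimit.post_post _ _ _ _ (zero_add 1) z).symm
  have := (shortExact hf hfg hg).extClass_naturality (shortExact hf' hfg' hg')
    { τ₁ := ModuleCat.ofHom a, τ₂ := ModuleCat.ofHom b, τ₃ := ModuleCat.ofHom c
      comm₁₂ := by ext x; exact (LinearMap.congr_fun hab x).symm
      comm₂₃ := by ext x; exact (LinearMap.congr_fun hbc x).symm }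
  exact congrArg (fun β => ExtLimit.post I β rfl z) this

end Connecting

section Zero

variable (I M) in
/-- The zeroth local cohomology maps to the module. -/
noncomputable def toModule : LC I 0 M →ₗ[A] M :=
  Module.DirectLimit.lift A ℕ _ (extPowMap I 0 (ModuleCat.of A M)) (fun k =>
    { toFun := fun x => (Abelian.Ext.linearEquiv₀ (R := A) x).hom (Submodule.Quotient.mk 1)
      map_add' := fun x y => by rw [_root_.map_add]; rfl
      map_smul' := fun a x => by rw [_root_.map_smul]; rfl }) (by
    intro j k h x
    obtain ⟨φ, rfl⟩ := (Abelian.Ext.linearEquiv₀ (R := A)).symm.surjective x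
    change (Abelian.Ext.linearEquiv₀ (R := A) ((Abelian.Ext.mk₀ (powFactor I h)).comp
      (Abelian.Ext.mk₀ φ) (zero_add 0))).hom (Submodule.Quotient.mk 1) = 
      (Abelian.Ext.linearEquiv₀ (R := A) (Abelian.Ext.mk₀ φ)).hom (Submodule.Quotient.mk 1)
    rw [Abelian.Ext.mk₀_comp_mk₀]
    have key {X Y : ModuleCat.{u} A} (ψ : X ⟶ Y) :
      Abelian.Ext.linearEquiv₀ (R := A) (Abelian.Ext.mk₀ ψ) = ψ :=
        (Abelian.Ext.linearEquiv₀ (R := A)).apply_symm_apply ψ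
    rw [key, key]
    rfl)

lemma toModule_of (k : ℕ) (φ : ModuleCat.of A (A ⧸ I ^ k) ⟶ ModuleCat.of A M) :
    toModule I M (ExtLimit.of I 0 (ModuleCat.of A M) k (Abelian.Ext.mk₀ φ)) =
      φ.hom (Submodule.Quotient.mk 1) := by
  refine (Module.DirectLimit.lift_of _ _ _).trans ?_
  exact congrArg (fun ψ => ModuleCat.Hom.hom ψ (Submodule.Quotient.mk 1))
    ((Abelian.Ext.linearEquiv₀ (R := A)).apply_symm_apply φ)

lemma exists_of_mk₀ (z : LC I 0 M) : ∃ (k : ℕ)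
    (φ : ModuleCat.of A (A ⧸ I ^ k) ⟶ ModuleCat.of A M),
    ExtLimit.of I 0 (ModuleCat.of A M) k (Abelian.Ext.mk₀ φ) = z := by
  obtain ⟨k, x, rfl⟩ := Module.DirectLimit.exists_of z
  obtain ⟨φ, rfl⟩ := (Abelian.Ext.linearEquiv₀ (R := A)).symm.surjective x
  exact ⟨k, φ, rfl⟩

lemma toModule_map (f : M →ₗ[A] N) (z : LC I 0 M) :
    toModule I N (map I 0 f z) = f (toModule I M z) := by
  obtain ⟨k, φ, rfl⟩ := exists_of_mk₀ z
  rw [toModule_of]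
  refine (congrArg (toModule I N) (ExtLimit.post_of _ _ k _)).trans ?_
  rw [Abelian.Ext.mk₀_comp_mk₀]
  exact toModule_of k _

lemma toModule_injective : Function.Injective (toModule I M) := by
  rw [injective_iff_map_eq_zero]
  intro z hz
  obtain ⟨k, φ, rfl⟩ := exists_of_mk₀ z
  rw [toModule_of] at hz
  have : φ = 0 := by
    ext
    exact hz
  rw [this, Abelian.Ext.mk₀_zero, _root_.map_zero]
  rfl

lemma mem_range_toModule (m : M) :
    (∃ z, toModule I M z = m) ↔ ∃ k, ∀ a ∈ I ^ k, a • m = 0 := by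
  constructor
  · rintro ⟨z, rfl⟩
    obtain ⟨k, hk⟩ := exists_pow_smul_eq_zero z
    exact ⟨k, fun a ha => by rw [← _root_.map_smul, hk a ha, _root_.map_zero]⟩
  · rintro ⟨k, hk⟩
    let φ : A ⧸ I ^ k →ₗ[A] M := Submodule.liftQ _ (LinearMap.toSpanSingleton A M m) (by
      intro a ha
      simpa using hk a ha)
    refine ⟨ExtLimit.of I 0 (ModuleCat.of A M) k (Abelian.Ext.mk₀ (ModuleCat.ofHom φ)), ?_⟩
    rw [toModule_of]
    exact LinearMap.toSpanSingleton_apply_one A M m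

end Zero

end LC

namespace LC

section Torsion

variable {A : Type u} [CommRing A] {M N : Type u} [AddCommGroup M] [Module A M]
  [AddCommGroup N] [Module A N]

variable (M) in
/-- The submodule of elements annihilated by a power of `I`. -/
def torsion (I : Ideal A) : Submodule A M where
  carrier := {m | ∃ k, ∀ a ∈ I ^ k, a • m = 0}
  add_mem' := by
    rintro m n ⟨k, hk⟩ ⟨l, hl⟩
    refine ⟨max k l, fun a ha => ?_⟩
    rw [smul_add, hk a (Ideal.pow_le_pow_right (le_max_left k l) ha),
      hl a (Ideal.pow_le_pow_right (le_max_right k l) ha), add_zero]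
  zero_mem' := ⟨0, fun a _ => smul_zero a⟩
  smul_mem' := by
    rintro c m ⟨k, hk⟩
    exact ⟨k, fun a ha => by rw [smul_comm, hk a ha, smul_zero]⟩

lemma mem_torsion {I : Ideal A} {m : M} :
    m ∈ torsion M I ↔ ∃ k, ∀ a ∈ I ^ k, a • m = 0 := Iff.rfl

lemma torsion_mono {I J : Ideal A} (h : I ≤ J) : torsion M J ≤ torsion M I := by
  rintro m ⟨k, hk⟩
  exact ⟨k, fun a ha => hk a (Ideal.pow_right_mono h k ha)⟩

lemma torsion_sup (I J : Ideal A) : torsion M (I ⊔ J) = torsion M I ⊓ torsion M J := by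
  refine le_antisymm (le_inf (torsion_mono le_sup_left) (torsion_mono le_sup_right)) ?_
  rintro m ⟨⟨k, hk⟩, ⟨l, hl⟩⟩
  refine ⟨k + l, fun a ha => ?_⟩
  obtain ⟨b, hb, c, hc, rfl⟩ := Submodule.mem_sup.1 (Ideal.sup_pow_add_le_pow_sup_pow ha)
  rw [add_smul, hk b hb, hl c hc, add_zero]

lemma torsion_bot : torsion M (⊥ : Ideal A) = ⊤ := by
  refine eq_top_iff.2 fun m _ => ⟨1, fun a ha => ?_⟩
  rw [pow_one] at ha
  rw [(Submodule.mem_bot A).1 ha, zero_smul]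

lemma mem_torsion_span_singleton {x : A} {m : M} :
    m ∈ torsion M (Ideal.span {x}) ↔ ∃ k : ℕ, x ^ k • m = 0 := by
  rw [mem_torsion]
  refine exists_congr fun k => ?_
  rw [Ideal.span_singleton_pow]
  refine ⟨fun h => h _ (Ideal.mem_span_singleton_self _), fun h a ha => ?_⟩
  obtain ⟨c, rfl⟩ := Ideal.mem_span_singleton'.1 ha
  rw [mul_smul, h, smul_zero]

lemma map_mem_torsion {I : Ideal A} (f : M →ₗ[A] N) {m : M} (hm : m ∈ torsion M I) :
    f m ∈ torsion N I := by
  obtain ⟨k, hk⟩ := hm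
  exact ⟨k, fun a ha => by rw [← map_smul, hk a ha, map_zero]⟩

lemma mem_torsion_of_map {I : Ideal A} {f : M →ₗ[A] N} (hf : Function.Injective f) {m : M}
    (hm : f m ∈ torsion N I) : m ∈ torsion M I := by
  obtain ⟨k, hk⟩ := hm
  exact ⟨k, fun a ha => hf (by rw [map_smul, hk a ha, map_zero])⟩

lemma torsion_torsion (I : Ideal A) (m : torsion M I) : m ∈ torsion (torsion M I) I :=
  mem_torsion_of_map (torsion M I).injective_subtype m.2

lemma mem_torsion_map {B : Type u} [CommRing B] [Algebra A B] [Module B M] [IsScalarTower A B M]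
    {I : Ideal A} {m : M} : m ∈ torsion M (I.map (algebraMap A B)) ↔ m ∈ torsion M I := by
  rw [mem_torsion, mem_torsion]
  refine exists_congr fun k => ?_
  rw [← Ideal.map_pow]
  refine ⟨fun h a ha => ?_, fun h => ?_⟩
  · rw [← algebraMap_smul B]
    exact h _ (Ideal.mem_map_of_mem _ ha)
  · intro b hb
    refine Submodule.span_induction (p := fun b _ => b • m = 0) ?_ (zero_smul _ _) ?_ ?_ hb
    · rintro _ ⟨a, ha, rfl⟩
      rw [algebraMap_smul]
      exact h a ha
    · intro x y _ _ hx hy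
      rw [add_smul, hx, hy, add_zero]
    · intro c x _ hx
      rw [smul_eq_mul, mul_smul, hx, smul_zero]

variable (A M) in
lemma exists_injective_embedding : ∃ (E : Type u) (_ : AddCommGroup E) (_ : Module A E)
    (_ : Module.Injective A E) (f : M →ₗ[A] E), Function.Injective f := by
  obtain ⟨J, _, f, _⟩ := EnoughInjectives.presentation (ModuleCat.of A M)
  exact ⟨J, _, _, Module.injective_module_of_injective_object A J, f.hom,
    (ModuleCat.mono_iff_injective f).mp ‹_›⟩

/-- Over a Noetherian ring a map from an ideal into a torsion submodule is killed by a power. -/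
lemma exists_pow_smul_map_eq_zero [IsNoetherianRing A] {I 𝔟 : Ideal A} (g : 𝔟 →ₗ[A] M)
    (hg : ∀ b, g b ∈ torsion M I) : ∃ k, ∀ a ∈ I ^ k, ∀ b, a • g b = 0 := by
  suffices H : ∀ P : Submodule A M, P.FG → P ≤ torsion M I →
      ∃ k, ∀ a ∈ I ^ k, ∀ m ∈ P, a • m = 0 by
    obtain ⟨k, hk⟩ := H (LinearMap.range g) (Module.Finite.fg_top.map g |> fun h => by
      rwa [LinearMap.range_eq_map]) (by rintro _ ⟨b, rfl⟩; exact hg b)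
    exact ⟨k, fun a ha b => hk a ha _ ⟨b, rfl⟩⟩
  intro P hP
  induction P, hP using Submodule.fg_induction with
  | singleton m =>
    intro h
    obtain ⟨k, hk⟩ := h (Submodule.mem_span_singleton_self m)
    refine ⟨k, fun a ha n hn => ?_⟩
    obtain ⟨c, rfl⟩ := Submodule.mem_span_singleton.1 hn
    rw [smul_comm, hk a ha, smul_zero]
  | sup P Q _ _ hP hQ =>
    intro h
    obtain ⟨k, hk⟩ := hP (le_sup_left.trans h)
    obtain ⟨l, hl⟩ := hQ (le_sup_right.trans h)
    refine ⟨max k l, fun a ha n hn => ?_⟩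
    obtain ⟨p, hp, q, hq, rfl⟩ := Submodule.mem_sup.1 hn
    rw [smul_add, hk a (Ideal.pow_le_pow_right (le_max_left k l) ha) p hp,
      hl a (Ideal.pow_le_pow_right (le_max_right k l) ha) q hq, add_zero]

instance injective_torsion [IsNoetherianRing A] [Module.Injective A M] (I : Ideal A) :
    Module.Injective A (torsion M I) := by
  refine Module.Baer.injective fun 𝔟 g => ?_
  obtain ⟨k, hk⟩ := exists_pow_smul_map_eq_zero g (fun b => torsion_torsion I (g b))
  obtain ⟨n, hn⟩ := Ideal.exists_pow_inf_eq_pow_smul I (𝔟 : Submodule A A)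
  have hle : ∀ b : 𝔟, (b : A) ∈ I ^ (n + k) → g b = 0 := by
    intro b hb
    have h1 : (b : A) ∈ (I ^ (n + k) • ⊤ ⊓ 𝔟 : Submodule A A) := ⟨by simpa using hb, b.2⟩
    rw [hn (n + k) (by lia), Nat.add_sub_cancel_left] at h1
    have h2 : (b : A) ∈ (I ^ k • (⊤ : Submodule A 𝔟)).map (Submodule.subtype 𝔟) := by
      rw [Submodule.map_smul'', Submodule.map_top, Submodule.range_subtype]
      exact (smul_mono_right _ inf_le_right :
        I ^ k • (I ^ n • (⊤ : Submodule A A) ⊓ 𝔟) ≤ I ^ k • (𝔟 : Submodule A A)) h1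
    obtain ⟨c, hc, hcb⟩ := h2
    obtain rfl : c = b := Subtype.ext hcb
    refine Submodule.smul_induction_on hc (p := fun c => g c = 0) ?_ ?_
    · intro a ha m _
      rw [map_smul, hk a ha]
    · intro x y hx hy
      rw [map_add, hx, hy, add_zero]
  let p : Submodule A 𝔟 := Submodule.comap (Submodule.subtype 𝔟) (I ^ (n + k))
  obtain ⟨h, hh⟩ := Module.Injective.out
    (Submodule.mapQ p (I ^ (n + k)) (Submodule.subtype 𝔟) le_rfl)
    (by
      rw [← LinearMap.ker_eq_bot, Submodule.mapQ, Submodule.ker_liftQ, LinearMap.ker_comp,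
        Submodule.ker_mkQ]
      exact Submodule.mkQ_map_self p)
    (p.liftQ (Submodule.subtype _ ∘ₗ g) (fun b hb => by
      simp [hle b hb]))
  refine ⟨LinearMap.toSpanSingleton A _ ⟨h (Submodule.Quotient.mk 1), n + k, fun a ha => ?_⟩, ?_⟩
  · rw [← map_smul, ← Submodule.Quotient.mk_smul, smul_eq_mul, mul_one,
      (Submodule.Quotient.mk_eq_zero _).2 ha, map_zero]
  · intro x hx
    refine Subtype.ext ?_
    change x • h (Submodule.Quotient.mk 1) = _
    rw [← map_smul, ← Submodule.Quotient.mk_smul, smul_eq_mul, mul_one]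
    exact hh (Submodule.Quotient.mk ⟨x, hx⟩)

instance injective_finsupp [IsNoetherianRing A] [Module.Injective A M] (ι : Type) :
    Module.Injective A (ι →₀ M) := by
  classical
  refine Module.Baer.injective fun 𝔟 g => ?_
  have h1 (n : ι) : ∃ e : M, ∀ b : 𝔟, g b n = (b : A) • e := by
    obtain ⟨h, hh⟩ := Module.Baer.of_injective ‹_› 𝔟 (Finsupp.lapply n ∘ₗ g)
    exact ⟨h 1, fun b => by rw [← map_smul, smul_eq_mul, mul_one]; exact (hh b b.2).symm⟩
  choose e he using h1
  have h2 : ∃ T : Finset ι, ∀ b, ∀ n ∉ T, g b n = 0 := by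
    obtain ⟨s, hs⟩ := (Module.Finite.fg_top (R := A) (M := 𝔟))
    refine ⟨s.biUnion fun b => (g b).support, fun b n hn => ?_⟩
    have hb : b ∈ Submodule.span A (s : Set 𝔟) := hs ▸ trivial
    refine Submodule.span_induction (p := fun b _ => g b n = 0) ?_ (by simp) ?_ ?_ hb
    · intro x hx
      by_contra h
      exact hn (Finset.mem_biUnion.2 ⟨x, hx, Finsupp.mem_support_iff.2 h⟩)
    · intro x y _ _ hx hy
      simp [hx, hy]
    · intro c x _ hx
      simp [hx]
  obtain ⟨T, hT⟩ := h2
  refine ⟨LinearMap.toSpanSingleton A _ (∑ n ∈ T, Finsupp.single n (e n)), fun x hx => ?_⟩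
  ext n
  rw [LinearMap.toSpanSingleton_apply, Finsupp.smul_apply, Finsupp.finsetSum_apply]
  simp only [Finsupp.single_apply]
  rw [Finset.sum_ite_eq' T n]
  split_ifs with h
  · exact (he n ⟨x, hx⟩).symm
  · rw [smul_zero, hT _ _ h]

end Torsion

section Vanishing

variable {A : Type u} [CommRing A] {M N L : Type u} [AddCommGroup M] [Module A M]
  [AddCommGroup N] [Module A N] [AddCommGroup L] [Module A L] {I : Ideal A} {i : ℕ}

lemma exists_toModule_eq {m : M} (hm : m ∈ torsion M I) : ∃ z, toModule I M z = m :=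
  (mem_range_toModule m).2 hm

lemma toModule_mem_torsion (z : LC I 0 M) : toModule I M z ∈ torsion M I :=
  (mem_range_toModule _).1 ⟨z, rfl⟩

lemma subsingleton_of_linearEquiv (e : M ≃ₗ[A] N) [Subsingleton (LC I i M)] :
    Subsingleton (LC I i N) := by
  refine subsingleton_of_forall_eq 0 fun z => ?_
  have h : map I i (e : M →ₗ[A] N) (map I i (e.symm : N →ₗ[A] M) z) = z := by
    rw [map_map]
    convert map_id z
    ext
    simp
  rw [← h, Subsingleton.elim (map I i (e.symm : N →ₗ[A] M) z) 0, map_zero]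

lemma subsingleton_of_exact {f : M →ₗ[A] N} {g : N →ₗ[A] L} (hf : Function.Injective f)
    (hfg : Function.Exact f g) (hg : Function.Surjective g) [Subsingleton (LC I i M)]
    [Subsingleton (LC I i L)] : Subsingleton (LC I i N) := by
  refine subsingleton_of_forall_eq 0 fun z => ?_
  obtain ⟨y, rfl⟩ := (exact_map_map hf hfg hg z).1 (Subsingleton.elim _ _)
  rw [Subsingleton.elim y 0, map_zero]

lemma δ_surjective {f : M →ₗ[A] N} {g : N →ₗ[A] L} (hf : Function.Injective f)
    (hfg : Function.Exact f g) (hg : Function.Surjective g) [Subsingleton (LC I (i + 1) N)] :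
    Function.Surjective (δ I i hf hfg hg) :=
  fun z => (exact_δ_map hf hfg hg z).1 (Subsingleton.elim _ _)

lemma subsingleton_of_δ {f : M →ₗ[A] N} {g : N →ₗ[A] L} (hf : Function.Injective f)
    (hfg : Function.Exact f g) (hg : Function.Surjective g) [Subsingleton (LC I (i + 1) N)]
    [Subsingleton (LC I i L)] : Subsingleton (LC I (i + 1) M) :=
  (δ_surjective hf hfg hg).subsingleton

instance subsingleton_of_injective [Module.Injective A M] : Subsingleton (LC I (i + 1) M) :=
  subsingleton_of_forall_eq 0 eq_zero_of_injective

lemma subsingleton_of_smul_injective {x : A} (hx : x ∈ I)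
    (h : ∀ z : LC I i M, x • z = 0 → z = 0) : Subsingleton (LC I i M) := by
  refine subsingleton_of_forall_eq 0 fun z => ?_
  obtain ⟨k, hk⟩ := exists_pow_smul_eq_zero z
  have h0 := hk _ (Ideal.pow_mem_pow hx k)
  clear hk
  induction k with
  | zero => simpa using h0
  | succ k ih => exact ih (h _ (by rw [← mul_smul, ← pow_succ', h0]))

lemma subsingleton_of_smul_bijective {x : A} (hx : x ∈ I)
    (h : Function.Bijective (fun m : M => x • m)) : Subsingleton (LC I i M) := by
  refine subsingleton_of_smul_injective hx fun z hz => ?_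
  let e : M ≃ₗ[A] M := LinearEquiv.ofBijective (x • LinearMap.id) h
  have h1 : map I i (e.symm : M →ₗ[A] M) (map I i (x • LinearMap.id) z) = z := by
    rw [map_map]
    convert map_id z
    ext m
    exact e.symm_apply_apply m
  rw [← h1, map_smul_id, hz, map_zero]

lemma exact_mkQ (f : M →ₗ[A] N) : Function.Exact f (LinearMap.range f).mkQ :=
  f.exact_map_mkQ_range

/-- Torsion modules have no higher local cohomology. -/
lemma subsingleton_of_torsion [IsNoetherianRing A] (h : torsion M I = ⊤) :
    Subsingleton (LC I (i + 1) M) := by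
  induction i generalizing M with
  | zero =>
    obtain ⟨E, _, _, _, f, hf⟩ := exists_injective_embedding A M
    let f' : M →ₗ[A] torsion E I := f.codRestrict _ fun m => map_mem_torsion f (h ▸ trivial)
    have hf' : Function.Injective f' := fun a b hab => hf (congrArg Subtype.val hab)
    refine subsingleton_of_forall_eq 0 fun z => ?_
    obtain ⟨y, rfl⟩ := δ_surjective hf' (exact_mkQ f') (Submodule.mkQ_surjective _) z
    obtain ⟨e, he⟩ := Submodule.mkQ_surjective _ (toModule I _ y)
    obtain ⟨w, rfl⟩ := exists_toModule_eq (torsion_torsion I e)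
    obtain rfl : map I 0 _ w = y := toModule_injective ((toModule_map _ w).trans he)
    exact (exact_map_δ hf' (exact_mkQ f') (Submodule.mkQ_surjective _)).apply_apply_eq_zero w
  | succ i ih =>
    obtain ⟨E, _, _, _, f, hf⟩ := exists_injective_embedding A M
    let f' : M →ₗ[A] torsion E I := f.codRestrict _ fun m => map_mem_torsion f (h ▸ trivial)
    have hf' : Function.Injective f' := fun a b hab => hf (congrArg Subtype.val hab)
    have : Subsingleton (LC I (i + 1) (torsion E I ⧸ LinearMap.range f')) := ih (by
      refine eq_top_iff.2 fun q _ => ?_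
      obtain ⟨e, rfl⟩ := Submodule.mkQ_surjective _ q
      exact map_mem_torsion _ (torsion_torsion I e))
    exact subsingleton_of_δ hf' (exact_mkQ f') (Submodule.mkQ_surjective _)

end Vanishing

end LC

namespace LC

section Restriction

variable {A B : Type u} [CommRing A] [CommRing B] [Algebra A B]

/-- An injective module modulo its `x`-torsion has bijective multiplication by `x`. -/
lemma smul_bijective_quotient_torsion [IsNoetherianRing B] {E : Type u} [AddCommGroup E]
    [Module B E] [Module.Injective B E] (x : B) :
    Function.Bijective (fun q : E ⧸ torsion E (Ideal.span {x}) => x • q) := by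
  constructor
  · refine (injective_iff_map_eq_zero
      (DistribSMul.toAddMonoidHom (E ⧸ torsion E (Ideal.span {x})) x)).2 ?_
    intro q hq
    obtain ⟨e, rfl⟩ := Submodule.mkQ_surjective _ q
    change x • Submodule.Quotient.mk e = (0 : E ⧸ torsion E (Ideal.span {x})) at hq
    rw [← Submodule.Quotient.mk_smul, Submodule.Quotient.mk_eq_zero,
      mem_torsion_span_singleton] at hq
    obtain ⟨k, hk⟩ := hq
    refine (Submodule.Quotient.mk_eq_zero _).2 (mem_torsion_span_singleton.2 ⟨k + 1, ?_⟩)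
    rw [pow_succ, mul_smul, hk]
  · intro q
    obtain ⟨e, rfl⟩ := Submodule.mkQ_surjective _ q
    let l (n : ℕ) : B →ₗ[B] B := LinearMap.toSpanSingleton B B (x ^ n)
    obtain ⟨n, hn⟩ := monotone_stabilizes_iff_noetherian.2 (inferInstanceAs (IsNoetherian B B))
      ⟨fun n => LinearMap.ker (l n), monotone_nat_of_le_succ fun n b hb => by
        have hb' : b * x ^ n = 0 := hb
        change b * x ^ (n + 1) = 0
        rw [pow_succ, ← mul_assoc, hb', zero_mul]⟩
    have hn1 : LinearMap.ker (l n) = LinearMap.ker (l (n + 1)) := hn (n + 1) (by lia)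
    obtain ⟨h, hh⟩ := Module.Injective.out
      ((LinearMap.ker (l (n + 1))).liftQ (l (n + 1)) le_rfl)
      (by rw [← LinearMap.ker_eq_bot]; exact Submodule.ker_liftQ_eq_bot' _ _ rfl)
      ((LinearMap.ker (l (n + 1))).liftQ (LinearMap.toSpanSingleton B E (x ^ n • e)) (by
        rw [← hn1]
        intro b hb
        have hb' : b * x ^ n = 0 := hb
        change b • x ^ n • e = 0
        rw [← mul_smul, hb', zero_smul]))
    have h1 : h (x ^ (n + 1)) = x ^ n • e := by
      have := hh (Submodule.Quotient.mk 1)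
      rw [Submodule.liftQ_apply, Submodule.liftQ_apply] at this
      simpa [l] using this
    refine ⟨Submodule.Quotient.mk (h 1), ?_⟩
    change x • Submodule.Quotient.mk (h 1) = Submodule.Quotient.mk e
    rw [← Submodule.Quotient.mk_smul, Submodule.Quotient.eq, mem_torsion_span_singleton]
    refine ⟨n, ?_⟩
    rw [smul_sub, ← mul_smul, ← pow_succ, ← map_smul, smul_eq_mul, mul_one, h1, sub_self]

/-- Injective modules over a Noetherian algebra are acyclic for local cohomology over the base. -/
lemma subsingleton_restrict_injective [IsNoetherianRing A] [IsNoetherianRing B] (I : Ideal A)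
    (E : Type u) [AddCommGroup E] [Module A E] [Module B E] [IsScalarTower A B E]
    [Module.Injective B E] (i : ℕ) : Subsingleton (LC I (i + 1) E) := by
  classical
  suffices H : ∀ (s : Finset A) (I₁ : Ideal A) (E : Type u) [AddCommGroup E] [Module A E]
      [Module B E] [IsScalarTower A B E] [Module.Injective B E], torsion E I₁ = ⊤ →
      Subsingleton (LC (I₁ ⊔ Ideal.span (s : Set A)) (i + 1) E) by
    obtain ⟨s, rfl⟩ := IsNoetherian.noetherian I
    rw [← bot_sup_eq (Submodule.span A _)]
    exact H s ⊥ E torsion_bot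
  intro s
  induction s using Finset.induction_on with
  | empty =>
    intro I₁ E _ _ _ _ _ h
    rw [Finset.coe_empty, Ideal.span_empty, sup_bot_eq]
    exact subsingleton_of_torsion h
  | insert x s _ ih =>
    intro I₁ E _ _ _ _ _ h
    let y : B := algebraMap A B x
    let Γ := torsion E (Ideal.span {y})
    have h1 : torsion Γ (I₁ ⊔ Ideal.span {x}) = ⊤ := by
      rw [torsion_sup]
      refine eq_top_iff.2 fun e _ => ⟨?_, ?_⟩
      · exact mem_torsion_of_map (f := Γ.subtype.restrictScalars A) Subtype.val_injective
          (h ▸ trivial)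
      · rw [SetLike.mem_coe, ← mem_torsion_map (B := B), Ideal.map_span, Set.image_singleton]
        exact torsion_torsion _ e
    have h2 := ih (I₁ ⊔ Ideal.span {x}) Γ h1
    rw [sup_assoc, ← Ideal.span_union, Set.singleton_union, ← Finset.coe_insert] at h2
    have h3 : Subsingleton (LC (I₁ ⊔ Ideal.span ((insert x s : Finset A) : Set A)) (i + 1)
        (E ⧸ Γ)) := by
      refine subsingleton_of_smul_bijective (x := x)
        (le_sup_right (α := Ideal A) (Ideal.subset_span (by simp))) ?_
      convert smul_bijective_quotient_torsion (E := E) y using 2 with q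
      exact (algebraMap_smul B x q).symm
    exact subsingleton_of_exact (f := Γ.subtype.restrictScalars A)
      (g := Γ.mkQ.restrictScalars A) Subtype.val_injective
      (LinearMap.exact_subtype_mkQ Γ) Γ.mkQ_surjective

/-- A bijection between quotients induced by a semilinear bijection matching the kernels. -/
lemma exists_addEquiv_of_surjective {X Z Y W : Type u} [AddCommGroup X] [Module A X]
    [AddCommGroup Z] [Module A Z] [AddCommGroup Y] [Module B Y] [AddCommGroup W] [Module B W]
    (f : X →ₗ[A] Z) (hf : Function.Surjective f) (g : Y →ₗ[B] W) (hg : Function.Surjective g)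
    (e : X ≃+ Y) (he : ∀ (a : A) x, e (a • x) = algebraMap A B a • e x)
    (h : ∀ x, f x = 0 ↔ g (e x) = 0) :
    ∃ e' : Z ≃+ W, ∀ (a : A) z, e' (a • z) = algebraMap A B a • e' z := by
  have hs (z : Z) : f (Function.surjInv hf z) = z := Function.surjInv_eq hf z
  have key (x x' : X) (hx : f x = f x') : g (e x) = g (e x') := by
    rw [← sub_eq_zero, ← map_sub, ← map_sub, ← h, map_sub, hx, sub_self]
  let φ : Z →+ W :=
    { toFun := fun z => g (e (Function.surjInv hf z))
      map_zero' := by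
        rw [← h, hs]
      map_add' := fun z z' => by
        rw [← map_add, ← map_add]
        exact key _ _ (by rw [map_add, hs, hs, hs]) }
  refine ⟨AddEquiv.ofBijective φ ⟨?_, ?_⟩, fun a z => ?_⟩
  · rw [injective_iff_map_eq_zero]
    intro z hz
    rw [← hs z, h]
    exact hz
  · intro w
    obtain ⟨y, rfl⟩ := hg w
    obtain ⟨x, rfl⟩ := e.surjective y
    exact ⟨f x, key _ _ (hs _)⟩
  · change g (e _) = algebraMap A B a • g (e _)
    rw [← map_smul, ← he]
    exact key _ _ (by rw [map_smul, hs, hs])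

lemma exists_addEquiv_zero {I : Ideal A} {K : Ideal B} (N : Type u)
    [AddCommGroup N] [Module A N] [Module B N] [IsScalarTower A B N] (hN : torsion N K = ⊤) :
    ∃ e : LC I 0 N ≃+ LC (I.map (algebraMap A B) ⊔ K) 0 N,
      (∀ (a : A) z, e (a • z) = algebraMap A B a • e z) ∧
      ∀ z, toModule _ N (e z) = toModule I N z := by
  have h1 (m : N) : m ∈ torsion N (I.map (algebraMap A B) ⊔ K) ↔ m ∈ torsion N I := by
    rw [torsion_sup, hN, inf_top_eq, mem_torsion_map]
  have h2 (z : LC I 0 N) : ∃ w : LC (I.map (algebraMap A B) ⊔ K) 0 N,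
      toModule _ N w = toModule I N z :=
    exists_toModule_eq ((h1 _).2 (toModule_mem_torsion z))
  choose φ hφ using h2
  let ψ : LC I 0 N →+ LC (I.map (algebraMap A B) ⊔ K) 0 N :=
    { toFun := φ
      map_zero' := toModule_injective (by rw [hφ, map_zero, map_zero])
      map_add' := fun x y => toModule_injective (by rw [hφ, map_add, map_add, hφ, hφ]) }
  refine ⟨AddEquiv.ofBijective ψ ⟨fun x y hxy => ?_, fun w => ?_⟩, fun a z => ?_, hφ⟩
  · refine toModule_injective ?_
    rw [← hφ, ← hφ]
    exact congrArg _ hxy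
  · obtain ⟨z, hz⟩ := exists_toModule_eq ((h1 _).1 (toModule_mem_torsion w))
    exact ⟨z, toModule_injective ((hφ z).trans hz)⟩
  · refine toModule_injective ?_
    change toModule _ N (φ (a • z)) = toModule _ N (algebraMap A B a • φ z)
    rw [(toModule _ N).map_smul (algebraMap A B a), hφ, hφ, (toModule I N).map_smul,
      algebraMap_smul]

/-- Local cohomology of a torsion module computed over the base ring. -/
theorem exists_addEquiv [IsNoetherianRing A] [IsNoetherianRing B] (I : Ideal A) (K : Ideal B)
    (N : Type u) [AddCommGroup N] [Module A N] [Module B N] [IsScalarTower A B N]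
    (hN : torsion N K = ⊤) (i : ℕ) :
    ∃ e : LC I i N ≃+ LC (I.map (algebraMap A B) ⊔ K) i N,
      ∀ (a : A) z, e (a • z) = algebraMap A B a • e z := by
  induction i generalizing N with
  | zero =>
    obtain ⟨e, he, _⟩ := exists_addEquiv_zero (I := I) N hN
    exact ⟨e, he⟩
  | succ i ih =>
    obtain ⟨E, _, _, _, f, hf⟩ := exists_injective_embedding B N
    let _ : Module A E := Module.compHom E (algebraMap A B)
    have : IsScalarTower A B E := IsScalarTower.of_algebraMap_smul fun a e => rfl
    let f' : N →ₗ[B] torsion E K := f.codRestrict _ fun m => map_mem_torsion f (hN ▸ trivial)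
    have hf' : Function.Injective f' := fun a b hab => hf (congrArg Subtype.val hab)
    let Q := torsion E K ⧸ LinearMap.range f'
    have hE : torsion (torsion E K) K = ⊤ := eq_top_iff.2 fun e _ => torsion_torsion K e
    have hQ : torsion Q K = ⊤ := by
      refine eq_top_iff.2 fun q _ => ?_
      obtain ⟨e, rfl⟩ := Submodule.mkQ_surjective _ q
      exact map_mem_torsion _ (torsion_torsion K e)
    have : Subsingleton (LC I (i + 1) (torsion E K)) :=
      subsingleton_restrict_injective (B := B) I _ i
    have hex := exact_mkQ f'
    have hsurj : Function.Surjective (LinearMap.range f').mkQ := Submodule.mkQ_surjective _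
    let δA := δ I i (f := f'.restrictScalars A) (g := (LinearMap.range f').mkQ.restrictScalars A)
      hf' hex hsurj
    let δB := δ (I.map (algebraMap A B) ⊔ K) i hf' hex hsurj
    have hδA : Function.Surjective δA := δ_surjective _ _ _
    have hδB : Function.Surjective δB := δ_surjective _ _ _
    rcases Nat.eq_zero_or_pos i with rfl | hi
    · obtain ⟨e, he, het⟩ := exists_addEquiv_zero (I := I) Q hQ
      obtain ⟨e', he', het'⟩ := exists_addEquiv_zero (I := I) (torsion E K) hE
      refine exists_addEquiv_of_surjective δA hδA δB hδB e he fun x => ?_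
      refine ((exact_map_δ _ _ _) x).trans (Iff.trans ?_ ((exact_map_δ _ _ _) (e x)).symm)
      have key (w : LC I 0 (torsion E K)) : e (map I 0
          ((LinearMap.range f').mkQ.restrictScalars A) w) =
          map (I.map (algebraMap A B) ⊔ K) 0 (LinearMap.range f').mkQ (e' w) := by
        refine toModule_injective ?_
        rw [het, toModule_map, toModule_map, het']
        rfl
      constructor
      · rintro ⟨w, rfl⟩
        exact ⟨e' w, (key w).symm⟩
      · rintro ⟨w, hw⟩
        refine ⟨e'.symm w, e.injective ?_⟩
        rw [key, e'.apply_symm_apply, hw]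
    · obtain ⟨j, rfl⟩ : ∃ j, i = j + 1 := ⟨i - 1, by lia⟩
      obtain ⟨e, he⟩ := ih Q hQ
      have : Subsingleton (LC I (j + 1) (torsion E K)) :=
        subsingleton_restrict_injective (B := B) I _ j
      refine exists_addEquiv_of_surjective δA hδA δB hδB e he fun x => ?_
      have h1 : δA x = 0 ↔ x = 0 := by
        refine ⟨fun h => ?_, fun h => by rw [h, map_zero]⟩
        obtain ⟨w, rfl⟩ := (exact_map_δ _ _ _ x).1 h
        rw [Subsingleton.elim w 0, map_zero]
      have h2 : δB (e x) = 0 ↔ e x = 0 := by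
        refine ⟨fun h => ?_, fun h => by rw [h, map_zero]⟩
        obtain ⟨w, hw⟩ := (exact_map_δ _ _ _ (e x)).1 h
        rw [← hw, Subsingleton.elim w 0, map_zero]
      rw [h1, h2, EmbeddingLike.map_eq_zero_iff]

end Restriction

section Finsupp

variable {A : Type u} [CommRing A] [IsNoetherianRing A]

/-- Local cohomology of a direct sum of copies is generated by the local cohomology of
the summands. -/
theorem lsum_map_lsingle_surjective (I : Ideal A) (M : Type u) [AddCommGroup M] [Module A M]
    (ι : Type) (i : ℕ) : Function.Surjective
      (Finsupp.lsum ℕ fun n : ι => map I i (Finsupp.lsingle (R := A) (M := M) n)) := by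
  classical
  induction i generalizing M with
  | zero =>
    intro z
    have h1 (n : ι) : toModule I _ z n ∈ torsion M I :=
      map_mem_torsion (Finsupp.lapply (R := A) n) (toModule_mem_torsion z)
    choose w hw using fun n => exists_toModule_eq (h1 n)
    refine ⟨∑ n ∈ (toModule I _ z).support, Finsupp.single n (w n), toModule_injective ?_⟩
    rw [map_sum, map_sum]
    simp only [Finsupp.lsum_single, toModule_map, hw, Finsupp.lsingle_apply]
    exact Finsupp.sum_single (toModule I _ z)
  | succ i ih =>
    intro z
    obtain ⟨E, _, _, _, f, hf⟩ := exists_injective_embedding A M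
    let Q := E ⧸ LinearMap.range f
    let π : E →ₗ[A] Q := (LinearMap.range f).mkQ
    have hπ : Function.Surjective π := Submodule.mkQ_surjective _
    have hex : Function.Exact f π := exact_mkQ f
    let F : (ι →₀ M) →ₗ[A] (ι →₀ E) := Finsupp.mapRange.linearMap f
    let G : (ι →₀ E) →ₗ[A] (ι →₀ Q) := Finsupp.mapRange.linearMap π
    have hF : Function.Injective F := Finsupp.mapRange_injective f (map_zero f) hf
    have hG : Function.Surjective G := Finsupp.mapRange_surjective π (map_zero π) hπ
    have hexF : Function.Exact F G := by
      intro x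
      constructor
      · intro hx
        have h1 (n : ι) : ∃ m, f m = x n :=
          (hex (x n)).1 (DFunLike.congr_fun hx n)
        choose m hm using h1
        refine ⟨Finsupp.onFinset x.support m fun n hn => ?_, ?_⟩
        · rw [Finsupp.mem_support_iff, ← hm]
          intro h
          exact hn (hf (h.trans (map_zero f).symm))
        · ext n
          exact hm n
      · rintro ⟨y, rfl⟩
        ext n
        exact hex.apply_apply_eq_zero (y n)
    obtain ⟨y, rfl⟩ := δ_surjective (i := i) hF hexF hG z
    obtain ⟨w, rfl⟩ := ih Q y
    refine ⟨Finsupp.mapRange.linearMap (δ I i hf hex hπ) w, ?_⟩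
    induction w using Finsupp.induction_linear with
    | zero => simp only [map_zero]
    | add x y hx hy => simp only [map_add, hx, hy]
    | single n q =>
      rw [Finsupp.mapRange.linearMap_apply, Finsupp.mapRange_single, Finsupp.lsum_single,
        Finsupp.lsum_single]
      refine map_δ hf hex hπ hF hexF hG _ (Finsupp.lsingle n) _ ?_ ?_ q
      · ext m
        simp [F]
      · ext e
        simp [G]

end Finsupp

end LC

namespace LC

/-- If `B ⧸ S` is a `K`-torsion module which is a direct sum of copies of `R`, and the
local cohomology of `B` vanishes in degree `d + 1`, then the local cohomology of `S` in degree
`d + 1` is a quotient of a direct sum of copies of that of `R` in degree `d`. -/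
theorem exists_surjective_of_extension {R S B N : Type u} [CommRing R] [CommRing S] [CommRing B]
    [IsNoetherianRing R] [IsNoetherianRing S] [IsNoetherianRing B] [Algebra R S] [Algebra S B]
    (I : Ideal R) (K : Ideal S)
    [AddCommGroup N] [Module R N] [Module S N] [IsScalarTower R S N]
    (hinj : Function.Injective (algebraMap S B)) (π : B →ₗ[S] N) (hπ : Function.Surjective π)
    (hex : Function.Exact (algebraMap S B) π) (hN : torsion N K = ⊤)
    (e : (ℕ →₀ R) ≃ₗ[R] N) (d : ℕ)
    (hB : Subsingleton
      (LC ((I.map (algebraMap R S) ⊔ K).map (algebraMap S B)) (d + 1) B)) :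
    ∃ f : (ℕ →₀ LC I d R) →+ LC (I.map (algebraMap R S) ⊔ K) (d + 1) S,
      (∀ (r : R) x, f (r • x) = algebraMap R S r • f x) ∧ Function.Surjective f := by
  obtain ⟨φ, hφ⟩ := exists_addEquiv (B := S) I K N hN d
  have : Subsingleton (LC (I.map (algebraMap R S) ⊔ K) (d + 1) B) := by
    obtain ⟨ψ, _⟩ := exists_addEquiv (B := B) (I.map (algebraMap R S) ⊔ K) ⊥ B torsion_bot (d + 1)
    rw [sup_bot_eq] at ψ
    exact ψ.toEquiv.subsingleton
  let l : S →ₗ[S] B := Algebra.linearMap S B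
  have hl : Function.Injective l := hinj
  have hlπ : Function.Exact l π := hex
  let Δ := δ (I.map (algebraMap R S) ⊔ K) d hl hlπ hπ
  have hΔ : Function.Surjective Δ := δ_surjective hl hlπ hπ
  let s := Finsupp.lsum ℕ fun n : ℕ => map I d (Finsupp.lsingle (R := R) (M := R) n)
  have hs : Function.Surjective s := lsum_map_lsingle_surjective I R ℕ d
  let t := map I d (e : (ℕ →₀ R) →ₗ[R] N)
  have ht : Function.Surjective t := fun z => ⟨map I d (e.symm : N →ₗ[R] _) z, by
    refine (map_map _ _ z).trans ?_
    convert map_id z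
    ext
    simp⟩
  refine ⟨(Δ.toAddMonoidHom.comp φ.toAddMonoidHom).comp (t.toAddMonoidHom.comp s.toAddMonoidHom),
    fun r x => ?_, (hΔ.comp φ.surjective).comp (ht.comp hs)⟩
  change Δ (φ (t (s (r • x)))) = algebraMap R S r • Δ (φ (t (s x)))
  rw [s.map_smul, t.map_smul, hφ, Δ.map_smul]

end LC

theorem exists_directSum_localCohomology_surjective {R S : Type} [CommRing R] [CommRing S]
    [Algebra R S] (I : Ideal R) (J : Ideal S) (d i : ℕ)
    (f : (ℕ →₀ LC I d R) →+ LC J i S) (hf : ∀ (r : R) x, f (r • x) = algebraMap R S r • f x)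
    (hfs : Function.Surjective f) :
    ∃ f : (DirectSum ℕ fun _ : ℕ =>
        ((localCohomology I d).obj (ModuleCat.of R R))) →ₗ[R]
        (RestrictScalars R S ((localCohomology J i).obj (ModuleCat.of S S))),
      Function.Surjective f := by
  classical
  obtain ⟨e₁⟩ := exists_localCohomology_linearEquiv I d R
  obtain ⟨e₂⟩ := exists_localCohomology_linearEquiv J i S
  let g := (finsuppLEquivDirectSum R ((localCohomology I d).obj (ModuleCat.of R R)) ℕ).symm.trans
    (Finsupp.mapRange.linearEquiv e₁)
  let h : (ℕ →₀ LC I d R) →ₗ[R]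
      RestrictScalars R S ((localCohomology J i).obj (ModuleCat.of S S)) :=
    { toFun := fun x => e₂.symm (f x)
      map_add' := fun x y => by
        rw [map_add]
        exact e₂.symm.map_add _ _
      map_smul' := fun r x => by
        rw [hf]
        exact e₂.symm.map_smul _ _ }
  exact ⟨h ∘ₗ g.toLinearMap, (e₂.symm.surjective.comp hfs).comp g.surjective⟩

end LocalCohomology

section Dimension

open Polynomial

lemma WithBot.le_of_add_one_le_add_one {a b : WithBot ℕ∞} (h : a + 1 ≤ b + 1) : a ≤ b := by
  induction a using WithBot.recBotCoe with
  | bot => exact bot_le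
  | coe a =>
    induction b using WithBot.recBotCoe with
    | bot => exact absurd h (by simp)
    | coe b =>
      norm_cast at h ⊢
      exact (ENat.add_le_add_iff_right ENat.one_ne_top).1 h

lemma WithBot.lt_of_add_one_le_of_lt {a b : WithBot ℕ∞} {j : ℕ} (h : a + 1 ≤ b)
    (hb : b < ((j + 1 : ℕ) : WithBot ℕ∞)) : a < (j : WithBot ℕ∞) := by
  have h1 := h.trans_lt hb
  rw [← not_le] at h1 ⊢
  intro h2
  refine h1 ?_
  push_cast
  gcongr

variable {R : Type*} [CommRing R]

lemma ringKrullDim_quotient_add_one_le_of_lt {P Q : Ideal R} [P.IsPrime] (h : P < Q) :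
    ringKrullDim (R ⧸ Q) + 1 ≤ ringKrullDim (R ⧸ P) := by
  obtain ⟨x, hxQ, hxP⟩ := SetLike.exists_of_lt h
  refine ringKrullDim_succ_le_of_surjective (Ideal.Quotient.factor h.le)
    (Ideal.Quotient.factor_surjective h.le) (r := Ideal.Quotient.mk P x) ?_ ?_
  · rw [mem_nonZeroDivisors_iff_ne_zero, Ne, Ideal.Quotient.eq_zero_iff_mem]
    exact hxP
  · rw [Ideal.Quotient.factor_mk, Ideal.Quotient.eq_zero_iff_mem]
    exact hxQ

variable {D : Type*} [CommRing D] [Algebra R D]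

lemma ringKrullDim_aeval_range_le_of_mul_mem [IsDomain D] (C : Subalgebra R D)
    [IsNoetherianRing C] {u y : D}
    (hu : u ∈ C) (hu0 : u ≠ 0) (huy : u * y ∈ C) :
    ringKrullDim (aeval (R := C) y).range ≤ ringKrullDim C := by
  refine WithBot.le_of_add_one_le_add_one ?_
  rw [← Polynomial.ringKrullDim_of_isNoetherianRing (R := C)]
  refine ringKrullDim_succ_le_of_surjective (aeval (R := C) y).rangeRestrict.toRingHom
    (aeval (R := C) y).rangeRestrict_surjective
    (r := Polynomial.C ⟨u, hu⟩ * X - Polynomial.C ⟨u * y, huy⟩) ?_ ?_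
  · rw [mem_nonZeroDivisors_iff_ne_zero]
    intro h
    have := congrArg (fun p => p.coeff 1) h
    simp [coeff_C] at this
    exact hu0 (congrArg Subtype.val this)
  · refine Subtype.ext ?_
    change aeval y _ = (0 : D)
    rw [map_sub, map_mul, aeval_C, aeval_C, aeval_X]
    exact sub_self _

lemma ringKrullDim_adjoin_union_singleton (s : Set D) (y : D) :
    ringKrullDim (Algebra.adjoin R (s ∪ {y})) =
      ringKrullDim (aeval (R := Algebra.adjoin R s) y).range := by
  rw [Algebra.adjoin_union_eq_adjoin_adjoin, Algebra.adjoin_singleton_eq_range_aeval]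
  rfl

lemma ringKrullDim_adjoin_singleton_le [IsNoetherianRing R] (u : D) :
    ringKrullDim (Algebra.adjoin R {u}) ≤
      ringKrullDim (R ⧸ RingHom.ker (algebraMap R D)) + 1 := by
  rw [← Polynomial.ringKrullDim_of_isNoetherianRing]
  let I := RingHom.ker (algebraMap R D)
  let ψ : (R ⧸ I)[X] →+* D := eval₂RingHom (RingHom.kerLift (algebraMap R D)) u
  have hψ (p : R[X]) : ψ (p.map (Ideal.Quotient.mk I)) = aeval u p := by
    change Polynomial.eval₂ _ _ _ = _
    rw [eval₂_map]
    rfl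
  have hmem (q) : ψ q ∈ Algebra.adjoin R {u} := by
    obtain ⟨p, rfl⟩ := map_surjective (Ideal.Quotient.mk I) Ideal.Quotient.mk_surjective q
    exact hψ p ▸ aeval_mem_adjoin_singleton R u
  refine ringKrullDim_le_of_surjective (ψ.codRestrict (Algebra.adjoin R {u}) hmem) ?_
  rintro ⟨x, hx⟩
  obtain ⟨p, rfl⟩ := (Algebra.adjoin_singleton_eq_range_aeval R u).le hx
  exact ⟨p.map (Ideal.Quotient.mk I), Subtype.ext (hψ p)⟩

lemma isNoetherianRing_adjoin [IsNoetherianRing R] {s : Set D} (hs : s.Finite) :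
    IsNoetherianRing (Algebra.adjoin R s) :=
  isNoetherianRing_of_fg (Subalgebra.fg_def.2 ⟨s, hs, rfl⟩)

/-- A domain generated by `u ≠ 0` and elements `y` with `u * y` in the base has dimension at most
one more than the base. -/
lemma ringKrullDim_adjoin_le [IsDomain D] [IsNoetherianRing R] {u : D} (hu : u ≠ 0) (Y : Finset D)
    (hY : ∀ y ∈ Y, u * y ∈ Set.range (algebraMap R D)) :
    ringKrullDim (Algebra.adjoin R ({u} ∪ (Y : Set D))) ≤
      ringKrullDim (R ⧸ RingHom.ker (algebraMap R D)) + 1 := by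
  classical
  induction Y using Finset.induction_on with
  | empty =>
    rw [Finset.coe_empty, Set.union_empty]
    exact ringKrullDim_adjoin_singleton_le u
  | insert y s _ ih =>
    refine le_trans ?_ (ih fun z hz => hY z (Finset.mem_insert_of_mem hz))
    have := isNoetherianRing_adjoin (R := R) (s := {u} ∪ (s : Set D))
      ((Set.finite_singleton u).union s.finite_toSet)
    rw [Finset.coe_insert, ← Set.union_singleton, ← Set.union_assoc,
      ringKrullDim_adjoin_union_singleton]
    refine ringKrullDim_aeval_range_le_of_mul_mem _
      (Algebra.subset_adjoin (Or.inl rfl)) hu ?_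
    obtain ⟨r, hr⟩ := hY y (Finset.mem_insert_self y s)
    rw [← hr]
    exact Subalgebra.algebraMap_mem _ r

end Dimension

section Step

namespace LC

variable {B : Type u} [CommRing B] {J : Ideal B}

lemma subsingleton_of_isPrime_of_sup {P : Ideal B} [P.IsPrime] {f : B} (hfJ : f ∈ J)
    (hfP : f ∉ P) {j : ℕ} (h : Subsingleton (LC J j (B ⧸ (P ⊔ Ideal.span {f})))) :
    Subsingleton (LC J (j + 1) (B ⧸ P)) := by
  let φ : (B ⧸ P) →ₗ[B] (B ⧸ P) := f • LinearMap.id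
  let ψ : (B ⧸ P) →ₗ[B] (B ⧸ (P ⊔ Ideal.span {f})) := Submodule.factor le_sup_left
  have hφ : Function.Injective φ := by
    refine (injective_iff_map_eq_zero φ).2 fun m hm => ?_
    obtain ⟨b, rfl⟩ := Ideal.Quotient.mk_surjective m
    have h1 : Ideal.Quotient.mk P (f * b) = 0 := hm
    rw [Ideal.Quotient.eq_zero_iff_mem] at h1 ⊢
    exact ((‹P.IsPrime›).mem_or_mem h1).resolve_left hfP
  have hψ : Function.Surjective ψ := Submodule.factor_surjective _
  have hex : Function.Exact φ ψ := by
    intro m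
    obtain ⟨b, rfl⟩ := Ideal.Quotient.mk_surjective m
    constructor
    · intro hm
      have h1 : b ∈ P ⊔ Ideal.span {f} := Ideal.Quotient.eq_zero_iff_mem.1 hm
      obtain ⟨p, hp, q, hq, rfl⟩ := Submodule.mem_sup.1 h1
      obtain ⟨c, rfl⟩ := Ideal.mem_span_singleton'.1 hq
      refine ⟨Ideal.Quotient.mk P c, ?_⟩
      change Ideal.Quotient.mk P (f * c) = _
      rw [Ideal.Quotient.eq]
      convert P.neg_mem hp using 1
      ring
    · rintro ⟨m, hm⟩
      obtain ⟨c, rfl⟩ := Ideal.Quotient.mk_surjective m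
      rw [← hm]
      refine (Ideal.Quotient.eq_zero_iff_mem (a := f * c)).2 ?_
      exact Ideal.mem_sup_right (Ideal.mul_mem_right _ _ (Ideal.mem_span_singleton_self f))
  refine subsingleton_of_smul_injective hfJ fun z hz => ?_
  rw [← map_smul_id] at hz
  obtain ⟨y, rfl⟩ := (exact_δ_map hφ hex hψ z).1 hz
  rw [Subsingleton.elim y 0, map_zero]

lemma subsingleton_of_comap_of_sup {K : Ideal B} (x : B) {i : ℕ}
    (h₁ : Subsingleton (LC J i (B ⧸ Submodule.comap (LinearMap.toSpanSingleton B B x) K)))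
    (h₂ : Subsingleton (LC J i (B ⧸ (K ⊔ Ideal.span {x})))) :
    Subsingleton (LC J i (B ⧸ K)) := by
  let K' : Ideal B := Submodule.comap (LinearMap.toSpanSingleton B B x) K
  let φ : (B ⧸ K') →ₗ[B] (B ⧸ K) := Submodule.mapQ K' K (LinearMap.toSpanSingleton B B x) le_rfl
  let ψ : (B ⧸ K) →ₗ[B] (B ⧸ (K ⊔ Ideal.span {x})) := Submodule.factor le_sup_left
  have hφ : Function.Injective φ := by
    refine (injective_iff_map_eq_zero φ).2 fun m hm => ?_
    obtain ⟨b, rfl⟩ := Ideal.Quotient.mk_surjective m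
    have h1 : Ideal.Quotient.mk K (b * x) = 0 := hm
    rw [Ideal.Quotient.eq_zero_iff_mem] at h1 ⊢
    exact h1
  have hψ : Function.Surjective ψ := Submodule.factor_surjective _
  have hex : Function.Exact φ ψ := by
    intro m
    obtain ⟨b, rfl⟩ := Ideal.Quotient.mk_surjective m
    constructor
    · intro hm
      have h1 : b ∈ K ⊔ Ideal.span {x} := Ideal.Quotient.eq_zero_iff_mem.1 hm
      obtain ⟨p, hp, q, hq, rfl⟩ := Submodule.mem_sup.1 h1
      obtain ⟨c, rfl⟩ := Ideal.mem_span_singleton'.1 hq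
      refine ⟨Ideal.Quotient.mk K' c, ?_⟩
      change Ideal.Quotient.mk K (c * x) = _
      rw [Ideal.Quotient.eq]
      convert K.neg_mem hp using 1
      ring
    · rintro ⟨m, hm⟩
      obtain ⟨c, rfl⟩ := Ideal.Quotient.mk_surjective m
      rw [← hm]
      refine (Ideal.Quotient.eq_zero_iff_mem (a := c * x)).2 ?_
      exact Ideal.mem_sup_right (Ideal.mul_mem_left _ _ (Ideal.mem_span_singleton_self x))
  exact subsingleton_of_exact hφ hex hψ

end LC

end Step

section Graded

variable {R B : Type u} [CommRing R] [CommRing B] [Algebra R B] {𝒜 : ℤ → Submodule R B}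
  [GradedAlgebra 𝒜]

lemma Ideal.IsHomogeneous.comap_toSpanSingleton {K : Ideal B} (hK : K.IsHomogeneous 𝒜) {x : B}
    (hx : SetLike.IsHomogeneousElem 𝒜 x) :
    Ideal.IsHomogeneous 𝒜 (Submodule.comap (LinearMap.toSpanSingleton B B x) K) := by
  obtain ⟨j, hj⟩ := hx
  intro i b hb
  have h := hK (i + j) (m := b * x) hb
  rw [DirectSum.coe_decompose_mul_add_of_right_mem 𝒜 hj] at h
  exact h

lemma Ideal.IsHomogeneous.of_mem_minimalPrimes {K Q : Ideal B} (hK : K.IsHomogeneous 𝒜)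
    (hQ : Q ∈ K.minimalPrimes) : Q.IsHomogeneous 𝒜 := by
  rw [Ideal.IsHomogeneous.iff_eq]
  refine le_antisymm (Ideal.toIdeal_homogeneousCore_le 𝒜 Q) (hQ.2 ⟨?_, ?_⟩
    (Ideal.toIdeal_homogeneousCore_le 𝒜 Q))
  · exact Ideal.IsPrime.homogeneousCore hQ.1.1
  · rw [← hK.toIdeal_homogeneousCore_eq_self]
    exact Ideal.homogeneousCore_mono 𝒜 hQ.1.2

lemma Ideal.IsHomogeneous.exists_homogeneous_notMem {Q Q' : Ideal B} (hQ : Q.IsHomogeneous 𝒜)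
    (h : ¬ Q ≤ Q') : ∃ (i : ℤ) (x : B), x ∈ 𝒜 i ∧ x ∈ Q ∧ x ∉ Q' := by
  classical
  obtain ⟨x, hx, hx'⟩ := SetLike.not_le_iff_exists.1 h
  by_contra! H
  refine hx' ?_
  rw [← DirectSum.sum_support_decompose 𝒜 x]
  exact Q'.sum_mem fun i _ => H i _ (SetLike.coe_mem _) (hQ i hx)

/-- Homogeneous prime avoidance, with an element of positive degree. -/
lemma exists_homogeneous_forall_notMem {Y : Set B} (hY : ∀ y ∈ Y, y ∈ 𝒜 1)
    (hne : ∃ y, y ∈ Y) (s : Finset (Ideal B)) (hp : ∀ Q ∈ s, Q.IsPrime)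
    (hh : ∀ Q ∈ s, Q.IsHomogeneous 𝒜) (hi : ∀ Q ∈ s, ∀ Q' ∈ s, Q ≤ Q' → Q = Q')
    (hYs : ∀ Q ∈ s, ∃ y ∈ Y, y ∉ Q) :
    ∃ (n : ℕ) (f : B), 0 < n ∧ f ∈ 𝒜 n ∧ f ∈ Ideal.span Y ∧ ∀ Q ∈ s, f ∉ Q := by
  classical
  induction s using Finset.induction_on with
  | empty =>
    obtain ⟨y, hy⟩ := hne
    exact ⟨1, y, one_pos, by exact_mod_cast hY y hy, Ideal.subset_span hy, by simp⟩
  | insert Q s hQs ih =>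
    obtain ⟨n, f, hn, hfn, hfY, hf⟩ := ih (fun Q' h => hp Q' (Finset.mem_insert_of_mem h))
      (fun Q' h => hh Q' (Finset.mem_insert_of_mem h))
      (fun Q' h Q'' h' => hi Q' (Finset.mem_insert_of_mem h) Q'' (Finset.mem_insert_of_mem h'))
      (fun Q' h => hYs Q' (Finset.mem_insert_of_mem h))
    have hQ := Finset.mem_insert_self Q s
    have hQp := hp Q hQ
    by_cases hfQ : f ∈ Q
    swap
    · refine ⟨n, f, hn, hfn, hfY, fun Q' h => ?_⟩
      obtain rfl | h := Finset.mem_insert.1 h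
      exacts [hfQ, hf Q' h]
    have hex (Q' : s) : ∃ (i : ℤ) (x : B), x ∈ 𝒜 i ∧ x ∈ Q'.1 ∧ x ∉ Q :=
      (hh Q' (Finset.mem_insert_of_mem Q'.2)).exists_homogeneous_notMem fun hle => hQs
        (hi Q' (Finset.mem_insert_of_mem Q'.2) Q hQ hle ▸ Q'.2)
    choose e x hxe hxQ' hxQ using hex
    obtain ⟨y, hyY, hyQ⟩ := hYs Q hQ
    have h1 : (∏ Q', x Q') ∈ 𝒜 (∑ Q', e Q') := SetLike.prod_mem_graded _ _ _ fun i _ => hxe i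
    obtain ⟨m, g, hm, hgm, hgY, hgQ, hgs⟩ : ∃ (m : ℕ) (g : B), 0 < m ∧ g ∈ 𝒜 m ∧
        g ∈ Ideal.span Y ∧ g ∉ Q ∧ ∀ Q' ∈ s, g ∈ Q' := by
      generalize (∑ Q', e Q') = d at h1
      refine ⟨(d + (d.natAbs + 1 : ℕ)).toNat, (∏ Q', x Q') * y ^ (d.natAbs + 1), by omega, ?_, ?_,
        ?_, ?_⟩
      · have h2 := SetLike.mul_mem_graded h1 (SetLike.pow_mem_graded (d.natAbs + 1) (hY y hyY))
        rw [Int.toNat_of_nonneg (by omega)]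
        simpa using h2
      · rw [pow_succ']
        exact Ideal.mul_mem_left _ _ (Ideal.mul_mem_right _ _ (Ideal.subset_span hyY))
      · intro h
        obtain h | h := hQp.mem_or_mem h
        · obtain ⟨i, _, hi⟩ := hQp.prod_mem_iff.1 h
          exact hxQ i hi
        · exact hyQ (hQp.mem_of_pow_mem _ h)
      · intro Q' hQ'
        exact Ideal.mul_mem_right _ _ (Ideal.prod_mem _ (Finset.mem_univ ⟨Q', hQ'⟩) (hxQ' ⟨Q', hQ'⟩))
    refine ⟨m * n, f ^ m + g ^ n, Nat.mul_pos hm hn, ?_, ?_, ?_⟩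
    · refine add_mem ?_ ?_
      · simpa using SetLike.pow_mem_graded m hfn
      · simpa [mul_comm] using SetLike.pow_mem_graded n hgm
    · exact add_mem (Ideal.pow_mem_of_mem _ hfY _ hm) (Ideal.pow_mem_of_mem _ hgY _ hn)
    · intro Q' hQ' h
      obtain rfl | hQ's := Finset.mem_insert.1 hQ'
      · rw [Ideal.add_mem_iff_right _ (Ideal.pow_mem_of_mem _ hfQ _ hm)] at h
        exact hgQ (hQp.mem_of_pow_mem _ h)
      · rw [Ideal.add_mem_iff_left _ (Ideal.pow_mem_of_mem _ (hgs Q' hQ's) _ hn)] at h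
        exact hf Q' hQ's ((hp Q' hQ').mem_of_pow_mem _ h)

end Graded

section ExtendedRees

variable {R B : Type u} [CommRing R] [CommRing B] [Algebra R B]

/-- A `ℤ`-graded algebra with the shape of an extended Rees algebra `R[𝔞t, t⁻¹]`. -/
structure IsExtendedReesLike (𝒜 : ℤ → Submodule R B) (u : B) (Y : Set B) : Prop where
  mem_neg_one : u ∈ 𝒜 (-1)
  mem_one : ∀ y ∈ Y, y ∈ 𝒜 1
  finite : Y.Finite
  adjoin_eq_top : Algebra.adjoin R ({u} ∪ Y) = ⊤
  exists_algebraMap_eq : ∀ b ∈ 𝒜 0, ∃ r, algebraMap R B r = b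

namespace IsExtendedReesLike

variable {𝒜 : ℤ → Submodule R B} {u : B} {Y : Set B}

lemma ringKrullDim_quotient_le_of_subset (h : IsExtendedReesLike 𝒜 u Y) {P : Ideal B}
    (hu : u ∈ P) (hY : Y ⊆ P) :
    ringKrullDim (B ⧸ P) ≤ ringKrullDim (R ⧸ P.comap (algebraMap R B)) := by
  refine ringKrullDim_le_of_surjective
    (Ideal.quotientMap P (algebraMap R B) le_rfl)
    (Ideal.Quotient.lift_surjective_of_surjective _ _ ?_)
  have h1 : (⊤ : Subalgebra R B) ≤ (⊥ : Subalgebra R (B ⧸ P)).comap (Ideal.Quotient.mkₐ R P) := by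
    rw [← h.adjoin_eq_top, Algebra.adjoin_le_iff]
    intro x hx
    have hx : x ∈ P := by
      obtain rfl | hx := hx
      exacts [hu, hY hx]
    have : Ideal.Quotient.mkₐ R P x = 0 := Ideal.Quotient.eq_zero_iff_mem.2 hx
    change Ideal.Quotient.mkₐ R P x ∈ (⊥ : Subalgebra R (B ⧸ P))
    rw [this]
    exact zero_mem _
  intro m
  obtain ⟨b, rfl⟩ := Ideal.Quotient.mk_surjective m
  exact Algebra.mem_bot.1 (h1 (Algebra.mem_top (x := b)))

/-- The dimension bound on `B ⧸ P` governing vanishing of local cohomology in degree `i`. -/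
def DimLT (_ : IsExtendedReesLike 𝒜 u Y) (P : Ideal B) (i : ℕ) : Prop :=
  (u ∉ P → ringKrullDim (R ⧸ P.comap (algebraMap R B)) < i) ∧
    (u ∈ P → ringKrullDim (B ⧸ P) < i)

lemma not_dimLT_zero (h : IsExtendedReesLike 𝒜 u Y) {P : Ideal B} [P.IsPrime] :
    ¬ h.DimLT P 0 := by
  rintro ⟨h1, h2⟩
  by_cases hu : u ∈ P
  · exact (h2 hu).not_ge ringKrullDim_nonneg_of_nontrivial
  · exact (h1 hu).not_ge ringKrullDim_nonneg_of_nontrivial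

variable [GradedAlgebra 𝒜]

lemma ringKrullDim_quotient_le_add_one [IsNoetherianRing R] (h : IsExtendedReesLike 𝒜 u Y)
    {P : Ideal B} [P.IsPrime] (hu : u ∉ P) :
    ringKrullDim (B ⧸ P) ≤ ringKrullDim (R ⧸ P.comap (algebraMap R B)) + 1 := by
  classical
  have hker : RingHom.ker (algebraMap R (B ⧸ P)) = P.comap (algebraMap R B) := by
    ext r
    exact Ideal.Quotient.eq_zero_iff_mem
  have h0 : Ideal.Quotient.mkₐ R P u ≠ 0 := fun h0 => hu (Ideal.Quotient.eq_zero_iff_mem.1 h0)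
  have h1 := ringKrullDim_adjoin_le (R := R) h0 (h.finite.toFinset.image (Ideal.Quotient.mkₐ R P))
    fun y hy => by
      obtain ⟨y, hy', rfl⟩ := Finset.mem_image.1 hy
      obtain ⟨r, hr⟩ := h.exists_algebraMap_eq (u * y) (by
        simpa using SetLike.mul_mem_graded h.mem_neg_one (h.mem_one y
          (h.finite.mem_toFinset.1 hy')))
      exact ⟨r, by rw [← map_mul, ← hr]; rfl⟩
  have h2 : Algebra.adjoin R ({Ideal.Quotient.mkₐ R P u} ∪
      ((h.finite.toFinset.image (Ideal.Quotient.mkₐ R P) : Finset (B ⧸ P)) : Set (B ⧸ P))) = ⊤ := by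
    rw [Finset.coe_image, Set.Finite.coe_toFinset, ← Set.image_singleton, ← Set.image_union,
      ← AlgHom.map_adjoin, h.adjoin_eq_top, Algebra.map_top, AlgHom.range_eq_top]
    exact Ideal.Quotient.mkₐ_surjective R P
  rw [h2, hker] at h1
  exact (ringKrullDim_eq_of_ringEquiv (Subalgebra.topEquiv (R := R) (A := B ⧸ P)).toRingEquiv).symm.le.trans
    h1

lemma comap_lt_comap {P P' : Ideal B} (hle : P ≤ P') {r : R} (h' : algebraMap R B r ∈ P')
    (h : algebraMap R B r ∉ P) : P.comap (algebraMap R B) < P'.comap (algebraMap R B) :=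
  SetLike.lt_iff_le_and_exists.2 ⟨Ideal.comap_mono hle, r, h', h⟩

lemma lt_of_mem {P P' : Ideal B} (hle : P ≤ P') {f : B} (h' : f ∈ P') (h : f ∉ P) : P < P' :=
  SetLike.lt_iff_le_and_exists.2 ⟨hle, f, h', h⟩

lemma ringKrullDim_comap_lt {P P' : Ideal B} [P.IsPrime] (hle : P ≤ P') {r : R}
    (h' : algebraMap R B r ∈ P') (h : algebraMap R B r ∉ P) {j : ℕ}
    (hj : ringKrullDim (R ⧸ P.comap (algebraMap R B)) < ((j + 1 : ℕ) : WithBot ℕ∞)) :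
    ringKrullDim (R ⧸ P'.comap (algebraMap R B)) < j :=
  WithBot.lt_of_add_one_le_of_lt
    (ringKrullDim_quotient_add_one_le_of_lt (comap_lt_comap hle h' h)) hj

/-- The case `u ∉ P`, `Y ⊄ P` of `exists_notMem_forall_dimLT`. -/
lemma exists_notMem_forall_dimLT_of_notMem [IsNoetherianRing R] [IsNoetherianRing B]
    (h : IsExtendedReesLike 𝒜 u Y)
    {P : Ideal B} [hP : P.IsPrime] (hPh : P.IsHomogeneous 𝒜) (hu : u ∉ P) {y : B}
    (hyY : y ∈ Y) (hy : y ∉ P) {j : ℕ} (hj : h.DimLT P (j + 1)) :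
    ∃ f ∈ Ideal.span Y, SetLike.IsHomogeneousElem 𝒜 f ∧ f ∉ P ∧
      ∀ P' : Ideal B, P'.IsPrime → P'.IsHomogeneous 𝒜 → P ⊔ Ideal.span {f} ≤ P' →
        h.DimLT P' j := by
  classical
  have hjR := hj.1 hu
  have hPu : (P ⊔ Ideal.span {u}).IsHomogeneous 𝒜 := hPh.sup
    (Ideal.homogeneous_span 𝒜 _ fun x hx => ⟨-1, (Set.mem_singleton_iff.1 hx) ▸ h.mem_neg_one⟩)
  have hfin := (P ⊔ Ideal.span {u}).finite_minimalPrimes_of_isNoetherianRing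
  let s : Finset (Ideal B) := hfin.toFinset.filter fun Q => ∃ y ∈ Y, y ∉ Q
  have hs {Q : Ideal B} : Q ∈ s ↔ Q ∈ (P ⊔ Ideal.span {u}).minimalPrimes ∧ ∃ y ∈ Y, y ∉ Q := by
    simp [s]
  have hPQ {Q : Ideal B} (hQ : Q ∈ (P ⊔ Ideal.span {u}).minimalPrimes) : P ≤ Q ∧ u ∈ Q :=
    ⟨le_sup_left.trans hQ.1.2,
      hQ.1.2 (Ideal.mem_sup_right (Ideal.mem_span_singleton_self u))⟩
  obtain ⟨n, f, hn, hfn, hfY, hfs, hfP⟩ : ∃ (n : ℕ) (f : B), 0 < n ∧ f ∈ 𝒜 n ∧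
      f ∈ Ideal.span Y ∧ (∀ Q ∈ s, f ∉ Q) ∧ f ∉ P := by
    obtain hse | ⟨Q, hQ⟩ := s.eq_empty_or_nonempty
    · refine ⟨1, y, one_pos, by exact_mod_cast h.mem_one y hyY, Ideal.subset_span hyY, ?_, hy⟩
      simp [hse]
    · obtain ⟨n, f, hn, hfn, hfY, hfs⟩ := exists_homogeneous_forall_notMem h.mem_one ⟨y, hyY⟩ s
        (fun Q hQ => (hs.1 hQ).1.1.1) (fun Q hQ => hPu.of_mem_minimalPrimes (hs.1 hQ).1)
        (fun Q hQ Q' hQ' hle => le_antisymm hle ((hs.1 hQ').1.2 (hs.1 hQ).1.1 hle))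
        (fun Q hQ => (hs.1 hQ).2)
      exact ⟨n, f, hn, hfn, hfY, hfs, fun hf => hfs Q hQ ((hPQ (hs.1 hQ).1).1 hf)⟩
  refine ⟨f, hfY, ⟨n, hfn⟩, hfP, fun P' hP' hP'h hle => ?_⟩
  have hPP' : P ≤ P' := le_sup_left.trans hle
  have hfP' : f ∈ P' := hle (Ideal.mem_sup_right (Ideal.mem_span_singleton_self f))
  refine ⟨fun hu' => ?_, fun hu' => ?_⟩
  · obtain ⟨r, hr⟩ := h.exists_algebraMap_eq (u ^ n * f) (by
      simpa using SetLike.mul_mem_graded (SetLike.pow_mem_graded n h.mem_neg_one) hfn)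
    refine ringKrullDim_comap_lt hPP' (r := r) ?_ ?_ hjR
    · rw [hr]
      exact Ideal.mul_mem_left _ _ hfP'
    · rw [hr]
      intro hmem
      obtain hmem | hmem := hP.mem_or_mem hmem
      exacts [hu (hP.mem_of_pow_mem _ hmem), hfP hmem]
  · obtain ⟨Q, hQ, hQP'⟩ := Ideal.exists_minimalPrimes_le (I := P ⊔ Ideal.span {u}) (J := P')
      (sup_le hPP' ((Ideal.span_singleton_le_iff_mem _).2 hu'))
    by_cases hYQ : Y ⊆ Q
    · refine (h.ringKrullDim_quotient_le_of_subset hu' fun z hz => hQP' (hYQ hz)).trans_lt ?_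
      obtain ⟨r, hr⟩ := h.exists_algebraMap_eq (u * y) (by
        simpa using SetLike.mul_mem_graded h.mem_neg_one (h.mem_one y hyY))
      refine ringKrullDim_comap_lt hPP' (r := r) ?_ ?_ hjR
      · rw [hr]
        exact Ideal.mul_mem_right _ _ hu'
      · rw [hr]
        intro hmem
        obtain hmem | hmem := hP.mem_or_mem hmem
        exacts [hu hmem, hy hmem]
    · have hQs : Q ∈ s := hs.2 ⟨hQ, Set.not_subset.1 hYQ⟩
      have := hQ.1.1
      refine WithBot.lt_of_add_one_le_of_lt
        (ringKrullDim_quotient_add_one_le_of_lt (lt_of_mem hQP' hfP' (hfs Q hQs))) ?_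
      refine lt_of_le_of_lt (WithBot.le_of_add_one_le_add_one ?_) hjR
      exact (ringKrullDim_quotient_add_one_le_of_lt (lt_of_mem (hPQ hQ).1 (hPQ hQ).2 hu)).trans
        (h.ringKrullDim_quotient_le_add_one hu)

lemma exists_notMem_forall_dimLT [IsNoetherianRing R] [IsNoetherianRing B]
    (h : IsExtendedReesLike 𝒜 u Y) (I : Ideal R)
    {P : Ideal B} [hP : P.IsPrime] (hPh : P.IsHomogeneous 𝒜)
    (hJ : ¬ I.map (algebraMap R B) ⊔ Ideal.span Y ≤ P) {j : ℕ} (hj : h.DimLT P (j + 1)) :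
    ∃ f ∈ I.map (algebraMap R B) ⊔ Ideal.span Y, SetLike.IsHomogeneousElem 𝒜 f ∧ f ∉ P ∧
      ∀ P' : Ideal B, P'.IsPrime → P'.IsHomogeneous 𝒜 → P ⊔ Ideal.span {f} ≤ P' →
        h.DimLT P' j := by
  by_cases hu : u ∈ P
  · obtain ⟨f, hfJ, hfh, hfP⟩ : ∃ f ∈ I.map (algebraMap R B) ⊔ Ideal.span Y,
        SetLike.IsHomogeneousElem 𝒜 f ∧ f ∉ P := by
      by_contra! H
      refine hJ (sup_le (Ideal.map_le_iff_le_comap.2 fun x hx => ?_)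
        (Ideal.span_le.2 fun y hy => ?_))
      · exact H _ (Ideal.mem_sup_left (Ideal.mem_map_of_mem _ hx))
          ⟨0, SetLike.algebraMap_mem_graded 𝒜 x⟩
      · exact H _ (Ideal.mem_sup_right (Ideal.subset_span hy)) ⟨1, h.mem_one y hy⟩
    refine ⟨f, hfJ, hfh, hfP, fun P' hP' _ hle => ⟨fun hu' => absurd (hle (Ideal.mem_sup_left hu)) hu',
      fun _ => ?_⟩⟩
    refine WithBot.lt_of_add_one_le_of_lt (ringKrullDim_quotient_add_one_le_of_lt ?_) (hj.2 hu)
    exact lt_of_mem (le_sup_left.trans hle)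
      (hle (Ideal.mem_sup_right (Ideal.mem_span_singleton_self f))) hfP
  by_cases hY : Y ⊆ P
  · obtain ⟨x, hxI, hxP⟩ : ∃ x ∈ I, algebraMap R B x ∉ P := by
      by_contra! H
      exact hJ (sup_le (Ideal.map_le_iff_le_comap.2 H) (Ideal.span_le.2 hY))
    refine ⟨algebraMap R B x, Ideal.mem_sup_left (Ideal.mem_map_of_mem _ hxI),
      ⟨0, SetLike.algebraMap_mem_graded 𝒜 x⟩, hxP, fun P' hP' _ hle => ?_⟩
    have hlt := ringKrullDim_comap_lt (le_sup_left.trans hle)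
      (hle (Ideal.mem_sup_right (Ideal.mem_span_singleton_self _))) hxP (hj.1 hu)
    exact ⟨fun _ => hlt, fun hu' => (h.ringKrullDim_quotient_le_of_subset hu'
      fun z hz => hle (Ideal.mem_sup_left (hY hz))).trans_lt hlt⟩
  · obtain ⟨y, hyY, hy⟩ := Set.not_subset.1 hY
    obtain ⟨f, hf, H⟩ := h.exists_notMem_forall_dimLT_of_notMem hPh hu hyY hy hj
    exact ⟨f, Ideal.mem_sup_right hf, H⟩

/-- Vanishing of the local cohomology of graded cyclic modules. -/
theorem subsingleton_localCohomology_quotient [IsNoetherianRing R] [IsNoetherianRing B]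
    (h : IsExtendedReesLike 𝒜 u Y) (I : Ideal R) (K : Ideal B) (hK : K.IsHomogeneous 𝒜) (i : ℕ)
    (hdim : ∀ P : Ideal B, P.IsPrime → P.IsHomogeneous 𝒜 → K ≤ P → h.DimLT P i) :
    Subsingleton (LC (I.map (algebraMap R B) ⊔ Ideal.span Y) i (B ⧸ K)) := by
  induction K using WellFoundedGT.induction generalizing i with
  | ind K ih =>
  set J := I.map (algebraMap R B) ⊔ Ideal.span Y with hJ
  by_cases hKp : K.IsPrime
  · obtain _ | j := i
    · exact absurd (hdim K hKp hK le_rfl) h.not_dimLT_zero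
    by_cases hJK : J ≤ K
    · refine LC.subsingleton_of_torsion (eq_top_iff.2 fun m _ => ⟨1, fun a ha => ?_⟩)
      rw [pow_one] at ha
      obtain ⟨b, rfl⟩ := Ideal.Quotient.mk_surjective m
      exact (Ideal.Quotient.eq_zero_iff_mem (a := a * b)).2 (Ideal.mul_mem_right _ _ (hJK ha))
    · obtain ⟨f, hfJ, hfh, hfK, hf⟩ := h.exists_notMem_forall_dimLT I hK hJK
        (hdim K hKp hK le_rfl)
      refine LC.subsingleton_of_isPrime_of_sup hfJ hfK (ih _ ?_ ?_ j hf)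
      · exact lt_of_mem le_sup_left (Ideal.mem_sup_right (Ideal.mem_span_singleton_self f)) hfK
      · exact hK.sup (Ideal.homogeneous_span 𝒜 _ fun x hx => Set.mem_singleton_iff.1 hx ▸ hfh)
  · by_cases hKtop : K = ⊤
    · have : Subsingleton (B ⧸ K) := Ideal.Quotient.subsingleton_iff.2 hKtop
      refine LC.subsingleton_of_smul_bijective (x := 0) J.zero_mem ?_
      exact ⟨fun _ _ _ => Subsingleton.elim _ _, fun b => ⟨b, Subsingleton.elim _ _⟩⟩
    · obtain ⟨x, y, hx, hy, hxy, hxK, hyK⟩ : ∃ x y : B, SetLike.IsHomogeneousElem 𝒜 x ∧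
          SetLike.IsHomogeneousElem 𝒜 y ∧ x * y ∈ K ∧ x ∉ K ∧ y ∉ K := by
        by_contra! H
        refine hKp (hK.isPrime_of_homogeneous_mem_or_mem hKtop fun {x y} hx hy hxy => ?_)
        by_contra! H'
        exact H'.2 (H x y hx hy hxy H'.1)
      have hle : K ≤ Submodule.comap (LinearMap.toSpanSingleton B B x) K :=
        fun b hb => Ideal.mul_mem_right _ _ hb
      refine LC.subsingleton_of_comap_of_sup x
        (ih _ (lt_of_mem hle (f := y) ?_ hyK) (hK.comap_toSpanSingleton hx) i
          fun P hP hPh hKP => hdim P hP hPh (hle.trans hKP))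
        (ih _ (lt_of_mem le_sup_left (Ideal.mem_sup_right (Ideal.mem_span_singleton_self x)) hxK)
          (hK.sup (Ideal.homogeneous_span 𝒜 _ fun z hz => Set.mem_singleton_iff.1 hz ▸ hx)) i
          fun P hP hPh hKP => hdim P hP hPh (le_sup_left.trans hKP))
      change y * x ∈ K
      rwa [mul_comm]

/-- The local cohomology of an extended Rees algebra at `(I, Y)` vanishes above the dimension
of the base. -/
theorem subsingleton_localCohomology [IsNoetherianRing R] [IsNoetherianRing B]
    (h : IsExtendedReesLike 𝒜 u Y) (hu : u ∈ nonZeroDivisors B) (I : Ideal R) {d : ℕ}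
    (hd : ringKrullDim R ≤ d) :
    Subsingleton (LC (I.map (algebraMap R B) ⊔ Ideal.span Y) (d + 1) B) := by
  have hlt {𝔭 : Ideal R} : ringKrullDim (R ⧸ 𝔭) < ((d + 1 : ℕ) : WithBot ℕ∞) :=
    ((ringKrullDim_quotient_le 𝔭).trans hd).trans_lt (by exact_mod_cast Nat.lt_succ_self d)
  have := h.subsingleton_localCohomology_quotient I ⊥ (Ideal.IsHomogeneous.bot 𝒜) (d + 1)
    fun P hP _ _ => by
      refine ⟨fun _ => hlt, fun huP => ?_⟩
      obtain ⟨P₀, hP₀, hle⟩ := Ideal.exists_minimalPrimes_le (I := ⊥) (J := P) bot_le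
      have := hP₀.1.1
      have huP₀ : u ∉ P₀ := fun hmem =>
        Set.disjoint_left.1 (Ideal.disjoint_nonZeroDivisors_of_mem_minimalPrimes hP₀) hmem hu
      refine lt_of_le_of_lt (WithBot.le_of_add_one_le_add_one ?_)
        (hlt (𝔭 := P₀.comap (algebraMap R B)))
      exact (ringKrullDim_quotient_add_one_le_of_lt (lt_of_mem hle huP huP₀)).trans
        (h.ringKrullDim_quotient_le_add_one huP₀)
  exact LC.subsingleton_of_linearEquiv (Submodule.quotEquivOfEqBot ⊥ rfl)

end IsExtendedReesLike

end ExtendedRees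

section ReesAlgebra

variable {R : Type u} [CommRing R] {𝔞 : Ideal R}

lemma LaurentPolynomial.coeff_C_mul_T (a : R) (n m : ℤ) :
    (C a * T n : R[T;T⁻¹]).coeff m = if n = m then a else 0 := by
  rw [← single_eq_C_mul_T]
  exact Finsupp.single_apply

lemma LaurentPolynomial.sum_C_mul_T (f : R[T;T⁻¹]) :
    ∑ n ∈ f.coeff.support, C (f.coeff n) * T n = f := by
  ext m
  rw [AddMonoidAlgebra.coeff_sum, Finsupp.finsetSum_apply]
  simp only [coeff_C_mul_T]
  simp

variable (𝔞) in
/-- The extended Rees algebra `R[𝔞t, t⁻¹]`. -/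
def extendedRees : Subalgebra R R[T;T⁻¹] where
  carrier := {f | ∀ n, f.coeff n ∈ 𝔞 ^ n.toNat}
  mul_mem' {f g} hf hg n := by
    classical
    rw [AddMonoidAlgebra.coeff_mul]
    refine Ideal.sum_mem _ fun i _ => Ideal.sum_mem _ fun j _ => ?_
    dsimp only
    split_ifs with h
    · have := Ideal.mul_mem_mul (hf i) (hg j)
      rw [← pow_add] at this
      exact Ideal.pow_le_pow_right (by omega) this
    · exact zero_mem _
  add_mem' hf hg n := Ideal.add_mem _ (hf n) (hg n)
  algebraMap_mem' r n := by
    rw [← C_eq_algebraMap, C_apply]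
    split_ifs with h
    · simp [h]
    · exact zero_mem _

lemma C_mul_T_mem_extendedRees {a : R} {n : ℤ} (h : a ∈ 𝔞 ^ n.toNat) :
    C a * T n ∈ extendedRees 𝔞 := by
  intro m
  rw [coeff_C_mul_T]
  split_ifs with hm
  · exact hm ▸ h
  · exact zero_mem _

lemma extendedRees_eq_top_of_forall_mem (W : Submodule R (extendedRees 𝔞))
    (h : ∀ (n : ℤ) (a : R) (ha : a ∈ 𝔞 ^ n.toNat), ⟨C a * T n, C_mul_T_mem_extendedRees ha⟩ ∈ W) :
    W = ⊤ := by
  refine eq_top_iff.2 fun f _ => ?_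
  have hf : f = ∑ n ∈ f.1.coeff.support,
      (⟨C (f.1.coeff n) * T n, C_mul_T_mem_extendedRees (f.2 n)⟩ : extendedRees 𝔞) := by
    refine Subtype.ext ?_
    rw [AddSubmonoidClass.coe_finsetSum]
    exact (sum_C_mul_T f.1).symm
  rw [hf]
  exact W.sum_mem fun n _ => h n _ (f.2 n)

variable (𝔞) in
/-- The Rees algebra `R[𝔞t]` inside the Laurent polynomials. -/
noncomputable abbrev laurentRees : Subalgebra R R[T;T⁻¹] :=
  Algebra.adjoin R {x : R[T;T⁻¹] | ∃ a ∈ 𝔞, C a * T 1 = x}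

lemma C_mul_T_mem_laurentRees {a : R} {n : ℕ} (h : a ∈ 𝔞 ^ n) :
    C a * T n ∈ laurentRees 𝔞 := by
  have h1 := monomial_mem_adjoin_monomial h
  have h2 : Algebra.adjoin R (Submodule.map (Polynomial.monomial 1 : R →ₗ[R] _) 𝔞 :
      Set (Polynomial R)) ≤ (laurentRees 𝔞).comap Polynomial.toLaurentAlg := by
    rw [Algebra.adjoin_le_iff]
    rintro _ ⟨b, hb, rfl⟩
    refine Algebra.subset_adjoin ⟨b, hb, ?_⟩
    change C b * T 1 = Polynomial.toLaurent (Polynomial.monomial 1 b)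
    rw [← Polynomial.C_mul_X_pow_eq_monomial, Polynomial.toLaurent_C_mul_X_pow, Nat.cast_one]
  have h3 : Polynomial.toLaurent (Polynomial.monomial n a) ∈ laurentRees 𝔞 := h2 h1
  rwa [← Polynomial.C_mul_X_pow_eq_monomial, Polynomial.toLaurent_C_mul_X_pow] at h3

lemma laurentRees_le : laurentRees 𝔞 ≤ extendedRees 𝔞 := by
  rw [Algebra.adjoin_le_iff]
  rintro _ ⟨a, ha, rfl⟩
  exact C_mul_T_mem_extendedRees (by simpa using ha)

lemma coeff_eq_zero_of_mem_laurentRees {f : R[T;T⁻¹]} (hf : f ∈ laurentRees 𝔞) {n : ℤ}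
    (hn : n < 0) : f.coeff n = 0 := by
  have h : laurentRees 𝔞 ≤ (Polynomial.toLaurentAlg (R := R)).range := by
    rw [Algebra.adjoin_le_iff]
    rintro _ ⟨a, ha, rfl⟩
    refine ⟨Polynomial.C a * Polynomial.X ^ 1, ?_⟩
    exact (Polynomial.toLaurent_C_mul_X_pow 1 a).trans (by rw [Nat.cast_one])
  obtain ⟨p, rfl⟩ := h hf
  refine Finsupp.mapDomain_of_notMem_range _ _ ?_
  rintro ⟨k, rfl⟩
  exact absurd hn (by simp)

lemma T_neg_one_mem_extendedRees : (T (-1) : R[T;T⁻¹]) ∈ extendedRees 𝔞 := by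
  simpa using C_mul_T_mem_extendedRees (𝔞 := 𝔞) (a := 1) (n := -1) (by simp)

/-- The grading of the extended Rees algebra by the exponent of `T`. -/
def extendedRees.grading (n : ℤ) : Submodule R (extendedRees 𝔞) where
  carrier := {f | ∀ m, m ≠ n → f.1.coeff m = 0}
  add_mem' {f g} hf hg m hm := by
    change f.1.coeff m + g.1.coeff m = 0
    rw [hf m hm, hg m hm, add_zero]
  zero_mem' _ _ := rfl
  smul_mem' r f hf m hm := by
    change r • f.1.coeff m = 0
    rw [hf m hm, smul_zero]

namespace extendedRees

lemma C_mul_T_mem_grading {a : R} {n : ℤ} (h : C a * T n ∈ extendedRees 𝔞) :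
    (⟨C a * T n, h⟩ : extendedRees 𝔞) ∈ grading (𝔞 := 𝔞) n := by
  intro m hm
  exact (coeff_C_mul_T a n m).trans (if_neg hm.symm)

instance : SetLike.GradedMonoid (grading (𝔞 := 𝔞)) where
  one_mem m hm := by
    change (1 : R[T;T⁻¹]).coeff m = 0
    rw [← map_one C, C_apply, if_neg hm]
  mul_mem i j f g hf hg m hm := by
    classical
    change (f.1 * g.1).coeff m = 0
    rw [AddMonoidAlgebra.coeff_mul]
    refine Finset.sum_eq_zero fun k _ => Finset.sum_eq_zero fun l _ => ?_
    dsimp only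
    split_ifs with h
    · by_cases hk : k = i
      · rw [hg l (by omega), mul_zero]
      · rw [hf k hk, zero_mul]
    · rfl

lemma isInternal_grading : DirectSum.IsInternal (grading (𝔞 := 𝔞)) := by
  classical
  have hcoeff (x : DirectSum ℤ fun n => grading (𝔞 := 𝔞) n) (n : ℤ) :
      (DirectSum.coeAddMonoidHom (grading (𝔞 := 𝔞)) x).1.coeff n = (x n).1.1.coeff n := by
    induction x using DirectSum.induction_on with
    | zero => simp
    | of i f =>
      rw [DirectSum.coeAddMonoidHom_of]
      by_cases h : i = n
      · subst h
        rw [DirectSum.of_eq_same]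
      · rw [DirectSum.of_eq_of_ne _ _ _ (Ne.symm h), f.2 n (Ne.symm h)]
        rfl
    | add x y hx hy =>
      rw [map_add, DirectSum.add_apply]
      change (DirectSum.coeAddMonoidHom (grading (𝔞 := 𝔞)) x).1.coeff n +
        (DirectSum.coeAddMonoidHom (grading (𝔞 := 𝔞)) y).1.coeff n =
        (x n).1.1.coeff n + (y n).1.1.coeff n
      rw [hx, hy]
  constructor
  · intro x y hxy
    refine DFinsupp.ext fun n => Subtype.ext (Subtype.ext (LaurentPolynomial.ext fun m => ?_))
    by_cases hm : m = n
    · subst hm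
      exact (hcoeff x m).symm.trans ((congrArg (fun f => f.1.coeff m) hxy).trans (hcoeff y m))
    · exact ((x n).2 m hm).trans ((y n).2 m hm).symm
  · intro f
    have h : LinearMap.range (DirectSum.coeLinearMap (grading (𝔞 := 𝔞))) = ⊤ :=
      extendedRees_eq_top_of_forall_mem _ fun n a ha =>
        ⟨DirectSum.of _ n ⟨_, C_mul_T_mem_grading (C_mul_T_mem_extendedRees ha)⟩,
          DirectSum.coeLinearMap_of _ _ _⟩
    exact LinearMap.range_eq_top.1 h f

noncomputable instance : GradedAlgebra (grading (𝔞 := 𝔞)) where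
  toDecomposition := isInternal_grading.chooseDecomposition

/-- The generators `a t` of positive degree, for `a` in a generating set of `𝔞`. -/
def generators (s : Set R) : Set (extendedRees 𝔞) :=
  {y | ∃ a ∈ s, y.1 = C a * T 1}

lemma adjoin_generators {s : Set R} (hs : Ideal.span s = 𝔞) :
    Algebra.adjoin R ({⟨T (-1), T_neg_one_mem_extendedRees⟩} ∪ generators (𝔞 := 𝔞) s) = ⊤ := by
  set W := Algebra.adjoin R
    ({⟨T (-1), T_neg_one_mem_extendedRees⟩} ∪ generators (𝔞 := 𝔞) s) with hW
  have hu : ⟨T (-1), T_neg_one_mem_extendedRees⟩ ∈ W := Algebra.subset_adjoin (Or.inl rfl)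
  have h1 : laurentRees 𝔞 ≤ W.map (extendedRees 𝔞).val := by
    rw [Algebra.adjoin_le_iff]
    rintro _ ⟨a, ha, rfl⟩
    rw [← hs] at ha
    induction ha using Submodule.span_induction with
    | mem a ha =>
      have h : C a * T 1 ∈ extendedRees 𝔞 :=
        C_mul_T_mem_extendedRees (by simpa [← hs] using Ideal.subset_span ha)
      exact ⟨⟨C a * T 1, h⟩, Algebra.subset_adjoin (Or.inr ⟨a, ha, rfl⟩), rfl⟩
    | zero =>
      rw [map_zero, zero_mul]
      exact zero_mem _
    | add a b _ _ ha hb =>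
      rw [map_add, add_mul]
      exact add_mem ha hb
    | smul r a _ ha =>
      rw [smul_eq_mul, map_mul, mul_assoc, ← smul_eq_C_mul]
      exact Subalgebra.smul_mem _ ha r
  refine (Algebra.toSubmodule_eq_top).1 (extendedRees_eq_top_of_forall_mem _ fun n a ha => ?_)
  change _ ∈ W
  obtain hn | hn := le_or_gt 0 n
  · obtain ⟨k, rfl⟩ := Int.eq_ofNat_of_zero_le hn
    obtain ⟨y, hy, hya⟩ := h1 (C_mul_T_mem_laurentRees (n := k) ha)
    have h : y = ⟨C a * T k, C_mul_T_mem_extendedRees ha⟩ := Subtype.ext hya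
    exact h ▸ hy
  · obtain ⟨k, rfl⟩ : ∃ k : ℕ, n = k * (-1) := ⟨(-n).toNat, by omega⟩
    convert Subalgebra.smul_mem W (pow_mem hu k) a
    rw [← smul_eq_C_mul, ← T_pow]
    rfl

lemma isExtendedReesLike {s : Set R} (hs : Ideal.span s = 𝔞) (hfin : s.Finite) :
    IsExtendedReesLike (grading (𝔞 := 𝔞)) ⟨T (-1), T_neg_one_mem_extendedRees⟩
      (generators (𝔞 := 𝔞) s) where
  mem_neg_one m hm := by
    change (T (-1) : R[T;T⁻¹]).coeff m = 0
    rw [T_apply, if_neg hm.symm]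
  mem_one := by
    rintro y ⟨a, _, hy⟩ m hm
    rw [hy, coeff_C_mul_T, if_neg hm.symm]
  finite := by
    refine Set.Finite.of_finite_image (f := Subtype.val)
      ((hfin.image fun a => C a * T 1).subset ?_) Subtype.val_injective.injOn
    rintro _ ⟨y, ⟨a, ha, hy⟩, rfl⟩
    exact ⟨a, ha, hy.symm⟩
  adjoin_eq_top := adjoin_generators hs
  exists_algebraMap_eq b hb := by
    refine ⟨b.1.coeff 0, Subtype.ext (LaurentPolynomial.ext fun n => ?_)⟩
    change (algebraMap R R[T;T⁻¹] _).coeff n = _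
    rw [← C_eq_algebraMap, C_apply]
    split_ifs with h
    · rw [h]
    · exact (hb n h).symm

lemma T_neg_one_mem_nonZeroDivisors :
    (⟨T (-1), T_neg_one_mem_extendedRees⟩ : extendedRees 𝔞) ∈ nonZeroDivisors (extendedRees 𝔞) := by
  rw [mem_nonZeroDivisors_iff_right]
  intro f hf
  have h : f.1 * T (-1) = 0 := congrArg Subtype.val hf
  exact Subtype.ext ((isUnit_T (-1)).mul_left_eq_zero.1 h)

instance [IsNoetherianRing R] : IsNoetherianRing (extendedRees 𝔞) := by
  obtain ⟨s, hs⟩ := IsNoetherian.noetherian 𝔞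
  have h := isExtendedReesLike (𝔞 := 𝔞) (s := s) hs s.finite_toSet
  have : Algebra.FiniteType R (extendedRees 𝔞) :=
    ⟨Subalgebra.fg_def.2 ⟨_, (Set.finite_singleton _).union h.finite, h.adjoin_eq_top⟩⟩
  exact Algebra.FiniteType.isNoetherianRing R _

end extendedRees

instance isNoetherianRing_laurentRees [IsNoetherianRing R] : IsNoetherianRing (laurentRees 𝔞) := by
  obtain ⟨s, hs⟩ := IsNoetherian.noetherian 𝔞
  let m : R →ₗ[R] R[T;T⁻¹] := AddMonoidAlgebra.lsingle 1
  have hm (a : R) : m a = C a * T 1 := single_eq_C_mul_T a 1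
  have h : laurentRees 𝔞 = Algebra.adjoin R (m '' s) := by
    rw [← Algebra.adjoin_span, ← Submodule.map_span, hs]
    exact congrArg (Algebra.adjoin R) (Set.ext fun x =>
      exists_congr fun a => and_congr_right fun _ => by rw [hm])
  rw [h]
  exact isNoetherianRing_of_fg (Subalgebra.fg_def.2 ⟨_, s.finite_toSet.image m, rfl⟩)

end ReesAlgebra

namespace laurentRees

variable {R : Type u} [CommRing R] {𝔞 : Ideal R}

noncomputable instance : Algebra (laurentRees 𝔞) (extendedRees 𝔞) :=
  (Subalgebra.inclusion laurentRees_le).toAlgebra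

instance : IsScalarTower R (laurentRees 𝔞) (extendedRees 𝔞) :=
  IsScalarTower.of_algebraMap_eq fun _ => rfl

lemma algebraMap_injective :
    Function.Injective (algebraMap (laurentRees 𝔞) (extendedRees 𝔞)) :=
  Subalgebra.inclusion_injective laurentRees_le

variable (𝔞) in
/-- The part of negative degree of the extended Rees algebra, as the cokernel of the
inclusion of the Rees algebra. -/
abbrev Cokernel : Type u :=
  extendedRees 𝔞 ⧸ LinearMap.range (Algebra.linearMap (laurentRees 𝔞) (extendedRees 𝔞))

variable (𝔞) in
/-- The ideal of the Rees algebra generated by the elements `a t` with `a ∈ 𝔞`. -/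
noncomputable def irrelevant : Ideal (laurentRees 𝔞) :=
  Ideal.span {y | ∃ a ∈ 𝔞, y.1 = C a * T 1}

/-- The multipliers of `f` into the Rees algebra. -/
noncomputable def multiplier (f : R[T;T⁻¹]) : Ideal (laurentRees 𝔞) where
  carrier := {s | s.1 * f ∈ laurentRees 𝔞}
  add_mem' {a b} ha hb := by
    change (a.1 + b.1) * f ∈ laurentRees 𝔞
    rw [add_mul]
    exact add_mem ha hb
  zero_mem' := by
    change 0 * f ∈ laurentRees 𝔞
    rw [zero_mul]
    exact zero_mem _
  smul_mem' c x hx := by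
    change c.1 * x.1 * f ∈ laurentRees 𝔞
    rw [mul_assoc]
    exact mul_mem c.2 hx

lemma irrelevant_pow_le_multiplier (k : ℕ) :
    irrelevant 𝔞 ^ k ≤ multiplier (T (-(k : ℤ))) := by
  induction k with
  | zero =>
    intro s _
    change s.1 * T _ ∈ laurentRees 𝔞
    simp
  | succ k ih =>
    rw [pow_succ, Ideal.mul_le]
    intro a ha b hb
    have h1 : irrelevant 𝔞 ≤ multiplier (T (-1)) := by
      refine Ideal.span_le.2 ?_
      rintro y ⟨c, _, hy⟩
      change y.1 * T (-1) ∈ laurentRees 𝔞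
      rw [hy, mul_assoc, ← T_add, add_neg_cancel, T_zero, mul_one, C_eq_algebraMap]
      exact Subalgebra.algebraMap_mem _ c
    have h : a.1 * T (-(k : ℤ)) * (b.1 * T (-1)) ∈ laurentRees 𝔞 := mul_mem (ih ha) (h1 hb)
    change a.1 * b.1 * T (-((k + 1 : ℕ) : ℤ)) ∈ laurentRees 𝔞
    rwa [mul_mul_mul_comm, ← T_add, show -(k : ℤ) + -1 = -((k + 1 : ℕ) : ℤ) by push_cast; ring] at h

lemma T_neg_mem_extendedRees (k : ℕ) : (T (-(k : ℤ)) : R[T;T⁻¹]) ∈ extendedRees 𝔞 := by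
  simpa using C_mul_T_mem_extendedRees (𝔞 := 𝔞) (a := 1) (n := -(k : ℤ)) (by simp)

variable (𝔞) in
/-- The `R`-linear map sending the `k`-th basis vector to `T (-(k + 1))`. -/
noncomputable def negativePart : (ℕ →₀ R) →ₗ[R] extendedRees 𝔞 :=
  Finsupp.linearCombination R fun k : ℕ => ⟨T (-((k + 1 : ℕ) : ℤ)), T_neg_mem_extendedRees (k + 1)⟩

lemma negativePart_single (k : ℕ) (r : R) :
    (negativePart 𝔞 (Finsupp.single k r)).1 = C r * T (-((k + 1 : ℕ) : ℤ)) := by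
  rw [negativePart, Finsupp.linearCombination_single, ← smul_eq_C_mul]
  rfl

lemma coeff_negativePart (c : ℕ →₀ R) (k : ℕ) :
    (negativePart 𝔞 c).1.coeff (-((k + 1 : ℕ) : ℤ)) = c k := by
  classical
  induction c using Finsupp.induction_linear with
  | zero => rw [map_zero]; rfl
  | add f g hf hg =>
    rw [map_add, Finsupp.add_apply, ← hf, ← hg]
    rfl
  | single j r =>
    rw [negativePart_single, coeff_C_mul_T, Finsupp.single_apply]
    exact if_congr (by omega) rfl rfl

lemma range_sup_range_negativePart :
    LinearMap.range (IsScalarTower.toAlgHom R (laurentRees 𝔞) (extendedRees 𝔞)).toLinearMap ⊔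
      LinearMap.range (negativePart 𝔞) = ⊤ := by
  refine extendedRees_eq_top_of_forall_mem _ fun n a ha => ?_
  obtain hn | hn := le_or_gt 0 n
  · obtain ⟨k, rfl⟩ := Int.eq_ofNat_of_zero_le hn
    exact Submodule.mem_sup_left ⟨⟨_, C_mul_T_mem_laurentRees (n := k) ha⟩, rfl⟩
  · obtain ⟨k, rfl⟩ : ∃ k : ℕ, n = -((k + 1 : ℕ) : ℤ) := ⟨(-n).toNat - 1, by omega⟩
    exact Submodule.mem_sup_right ⟨Finsupp.single k a, Subtype.ext (negativePart_single k a)⟩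

lemma bijective_mkQ_comp_negativePart :
    Function.Bijective
      ((LinearMap.range (Algebra.linearMap (laurentRees 𝔞) (extendedRees 𝔞))).mkQ.restrictScalars R ∘ₗ
        negativePart 𝔞) := by
  constructor
  · rw [← LinearMap.ker_eq_bot, LinearMap.ker_eq_bot']
    intro c hc
    obtain ⟨s, hs⟩ := (Submodule.Quotient.mk_eq_zero _).1 hc
    ext k
    rw [← coeff_negativePart (𝔞 := 𝔞), ← hs]
    exact coeff_eq_zero_of_mem_laurentRees s.2 (by omega)
  · intro y
    obtain ⟨f, rfl⟩ := Submodule.mkQ_surjective _ y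
    obtain ⟨_, ⟨s, rfl⟩, _, ⟨c, rfl⟩, rfl⟩ := Submodule.mem_sup.1
      (range_sup_range_negativePart (𝔞 := 𝔞) ▸ Submodule.mem_top (x := f))
    refine ⟨c, ?_⟩
    rw [map_add]
    have h : (LinearMap.range (Algebra.linearMap (laurentRees 𝔞) (extendedRees 𝔞))).mkQ
        ((IsScalarTower.toAlgHom R (laurentRees 𝔞) (extendedRees 𝔞)).toLinearMap s) = 0 :=
      (Submodule.Quotient.mk_eq_zero _).2 ⟨s, rfl⟩
    rw [h, zero_add]
    rfl

variable (𝔞) in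
/-- The cokernel is free over `R` with basis the classes of the negative powers of `T`. -/
noncomputable def cokernelEquiv : (ℕ →₀ R) ≃ₗ[R] Cokernel 𝔞 :=
  LinearEquiv.ofBijective _ bijective_mkQ_comp_negativePart

lemma torsion_cokernel : LC.torsion (Cokernel 𝔞) (irrelevant 𝔞) = ⊤ := by
  refine eq_top_iff.2 fun y _ => ?_
  obtain ⟨c, rfl⟩ := (cokernelEquiv 𝔞).surjective y
  induction c using Finsupp.induction_linear with
  | zero => rw [map_zero]; exact zero_mem _
  | add f g hf hg => rw [map_add]; exact add_mem (hf trivial) (hg trivial)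
  | single k r =>
    refine LC.mem_torsion.2 ⟨k + 1, fun s hs => (Submodule.Quotient.mk_eq_zero _).2 ?_⟩
    have h : s.1 * T (-((k + 1 : ℕ) : ℤ)) ∈ laurentRees 𝔞 := irrelevant_pow_le_multiplier _ hs
    refine ⟨r • ⟨_, h⟩, Subtype.ext ?_⟩
    change r • (s.1 * T (-((k + 1 : ℕ) : ℤ))) = s.1 * (negativePart 𝔞 (Finsupp.single k r)).1
    rw [negativePart_single, smul_eq_C_mul]
    ring

lemma map_irrelevant {s : Set R} (hs : Ideal.span s = 𝔞) :
    (irrelevant 𝔞).map (algebraMap (laurentRees 𝔞) (extendedRees 𝔞)) =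
      Ideal.span (extendedRees.generators s) := by
  refine le_antisymm ?_ ?_
  · rw [irrelevant, Ideal.map_span, Ideal.span_le]
    rintro _ ⟨y, ⟨a, ha, hy⟩, rfl⟩
    have hle : 𝔞 ≤ Submodule.comap (AddMonoidAlgebra.lsingle (R := R) (M := ℤ) 1)
        (((Ideal.span (extendedRees.generators (𝔞 := 𝔞) s)).restrictScalars R).map
          (extendedRees 𝔞).val.toLinearMap) := by
      rw [← hs, Ideal.span, Submodule.span_le]
      intro b hb
      have hmem : C b * T 1 ∈ extendedRees (Ideal.span s) :=
        C_mul_T_mem_extendedRees (by simpa using Ideal.subset_span hb)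
      exact ⟨⟨_, hmem⟩, Ideal.subset_span ⟨b, hb, rfl⟩, (single_eq_C_mul_T b 1).symm⟩
    obtain ⟨z, hz, hza⟩ := hle ha
    have : z = algebraMap (laurentRees 𝔞) (extendedRees 𝔞) y :=
      Subtype.ext (hza.trans ((single_eq_C_mul_T a 1).trans hy.symm))
    exact this ▸ hz
  · rw [Ideal.span_le]
    rintro y ⟨a, ha, hy⟩
    have ha' : a ∈ 𝔞 := hs ▸ Ideal.subset_span ha
    have h : C a * T 1 ∈ laurentRees 𝔞 := Algebra.subset_adjoin ⟨a, ha', rfl⟩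
    have : algebraMap (laurentRees 𝔞) (extendedRees 𝔞) ⟨_, h⟩ = y := Subtype.ext hy.symm
    exact this ▸ Ideal.mem_map_of_mem _ (Ideal.subset_span ⟨a, ha', rfl⟩)

theorem exists_localCohomology_surjective [IsNoetherianRing R] (I : Ideal R) {d : ℕ}
    (hd : ringKrullDim R ≤ d) :
    ∃ f : (ℕ →₀ LC I d R) →+
        LC (I.map (algebraMap R (laurentRees 𝔞)) ⊔ irrelevant 𝔞) (d + 1) (laurentRees 𝔞),
      (∀ (r : R) x, f (r • x) = algebraMap R (laurentRees 𝔞) r • f x) ∧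
        Function.Surjective f := by
  obtain ⟨s, hs⟩ := IsNoetherian.noetherian 𝔞
  refine LC.exists_surjective_of_extension (B := extendedRees 𝔞) I (irrelevant 𝔞)
    algebraMap_injective (Submodule.mkQ _) (Submodule.mkQ_surjective _)
    (LinearMap.exact_map_mkQ_range _) torsion_cokernel (cokernelEquiv 𝔞) d ?_
  rw [Ideal.map_sup, Ideal.map_map, ← IsScalarTower.algebraMap_eq, map_irrelevant hs]
  exact (extendedRees.isExtendedReesLike hs s.finite_toSet).subsingleton_localCohomology
    extendedRees.T_neg_one_mem_nonZeroDivisors I hd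

end laurentRees

end

/-- Let `(R,𝔪)` be a Noetherian local ring of Krull dimension `d ≥ 2` and
`𝔞 ⊊ R` a proper ideal of positive height (contained in no minimal prime of `R`),
`S = R[𝔞t]` the Rees algebra with maximal homogeneous ideal `𝔪_S`.  Then there is a
surjective `R`-linear map `⊕_{i ∈ ℕ} H^d_𝔪(R) ↠ H^{d+1}_{𝔪_S}(S)`. -/
theorem rees_top_localCohomology_surjection
    {R : Type} [CommRing R] [IsNoetherianRing R] [IsLocalRing R]
    (d : ℕ) (hd2 : 2 ≤ d) (hd : ringKrullDim R = d)
    (𝔞 : Ideal R) (h𝔞 : 𝔞 ≠ ⊤)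
    (hht : ∀ P ∈ minimalPrimes R, ¬ 𝔞 ≤ P)
    (S : Subalgebra R (LaurentPolynomial R))
    (hS : S = Algebra.adjoin R {x : LaurentPolynomial R | ∃ a ∈ 𝔞, C a * T 1 = x})
    (𝔪S : Ideal S)
    (h𝔪S : 𝔪S = Ideal.span
      ({y : S | ∃ x ∈ maximalIdeal R, (y : LaurentPolynomial R) = C x} ∪
        {y : S | ∃ a ∈ 𝔞, (y : LaurentPolynomial R) = C a * T 1})) :
    ∃ f : (DirectSum ℕ fun _ : ℕ =>
        ((localCohomology (maximalIdeal R) d).obj (ModuleCat.of R R))) →ₗ[R]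
        (RestrictScalars R S ((localCohomology 𝔪S (d + 1)).obj (ModuleCat.of S S))),
      Function.Surjective f := by
  subst hS
  have h : 𝔪S = (maximalIdeal R).map (algebraMap R (laurentRees 𝔞)) ⊔
      laurentRees.irrelevant 𝔞 := by
    rw [h𝔪S, Ideal.span_union, laurentRees.irrelevant, Ideal.map]
    refine congrArg (fun X => Ideal.span X ⊔ _) (Set.ext fun y => ⟨?_, ?_⟩)
    · rintro ⟨x, hx, hy⟩
      exact ⟨x, hx, Subtype.ext hy.symm⟩
    · rintro ⟨x, hx, rfl⟩
      exact ⟨x, hx, rfl⟩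
  rw [h]
  obtain ⟨f, hf, hfs⟩ :=
    laurentRees.exists_localCohomology_surjective (𝔞 := 𝔞) (maximalIdeal R) hd.le
  exact exists_directSum_localCohomology_surjective _ _ _ _ f hf hfs
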